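/- Let p be a prime, K = ℂ_p, π ∈ K with π^{p-1} = −p, and A an n×n nonnegative integer matrix with 0 < det A < p whose reduction is Berglund–Hübsch over the residue field of K. Then the power series Z_A(x) = exp(π(W_{pA}(x) − W_A(x))) ∈ K[[x_1,…,x_n]] is overconvergent, Θ''_A (multiplication by Z_A(x) Z_{A^T}(y)) is a well-defined linear map R^†_{pA}(K) → R^†_A(K), and Fr''_A = (Θ''_A ⊗ Id_{⋀(K^n)}) ∘ p^{Q^∨_{pA}} is a chain map B^†_{pA}(K) → B^†_A(K): Fr''_A ∘ (d_{pA} + d^∨_{pA}) = (d_A + d^∨_A) ∘ Fr''_A. -/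

import Mathlib

open scoped BigOperators TensorProduct
open Matrix Classical

noncomputable section

/-- The invertible-type polynomial `W_A = ∑ i, ∏ j, x_j ^ A i j`. -/
def Wpoly (F : Type) [Field F] {ι : Type} [Fintype ι] (A : Matrix ι ι ℕ) :
    MvPolynomial ι F :=
  ∑ i, ∏ j, MvPolynomial.X j ^ A i j

/-- `A` is a Berglund–Hübsch matrix over the field `F`. -/
def IsBH (F : Type) [Field F] {ι : Type} [Fintype ι] [LinearOrder ι]
    (A : Matrix ι ι ℕ) : Prop :=
  (A.map ((↑) : ℕ → ℚ)).det ≠ 0 ∧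
  (ringChar F = 0 ∨ ((A.map ((↑) : ℕ → ℤ)).det < (ringChar F : ℤ))) ∧
  (∃ q : ι → ℚ, (∀ j, 0 < q j) ∧ ∀ i, (∑ j, (A i j : ℚ) * q j) = 1) ∧
  RingTheory.Sequence.IsRegular (MvPolynomial ι F)
    ((Finset.univ.sort (· ≤ ·)).map fun i => MvPolynomial.pderiv i (Wpoly F A))

/-- The model for the exterior algebra `⋀(Fⁿ)`: the free `F`-module on the standard
basis monomials `e_S = e_{s_1} ∧ … ∧ e_{s_k}`, `s_1 < … < s_k`, indexed by finite sets. -/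
abbrev ExtV (F : Type) (ι : Type) := Finset ι → F

/-- Exterior multiplication by `e_i` on `⋀(Fⁿ)`. -/
def mulE (F : Type) [Field F] {ι : Type} [LinearOrder ι] (i : ι) :
    ExtV F ι →ₗ[F] ExtV F ι where
  toFun f S := if i ∈ S then (-1 : F) ^ (S.filter (· < i)).card * f (S.erase i) else 0
  map_add' f g := by
    funext S
    by_cases h : i ∈ S <;> simp [h, mul_add]
  map_smul' a f := by
    funext S
    by_cases h : i ∈ S <;> simp [h, mul_left_comm]

/-- Contraction `e_i^∨` on `⋀(Fⁿ)`. -/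
def contrE (F : Type) [Field F] {ι : Type} [LinearOrder ι] (i : ι) :
    ExtV F ι →ₗ[F] ExtV F ι where
  toFun f S := if i ∈ S then 0 else (-1 : F) ^ (S.filter (· < i)).card * f (insert i S)
  map_add' f g := by
    funext S
    by_cases h : i ∈ S <;> simp [h, mul_add]
  map_smul' a f := by
    funext S
    by_cases h : i ∈ S <;> simp [h, mul_left_comm]

/-- `E_{A,i} = π ∑_j A_{ij} e_j`. -/
def EA (F : Type) [Field F] {ι : Type} [Fintype ι] [LinearOrder ι]
    (π : F) (A : Matrix ι ι ℕ) (i : ι) : ExtV F ι →ₗ[F] ExtV F ι :=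
  π • ∑ j, (A i j : F) • mulE F j

/-- `E^∨_{A,i} = π⁻¹ ∑_j (A⁻¹)_{ji} e_j^∨`, the inverse matrix being computed over `F`. -/
def EAdual (F : Type) [Field F] {ι : Type} [Fintype ι] [LinearOrder ι]
    (π : F) (A : Matrix ι ι ℕ) (i : ι) : ExtV F ι →ₗ[F] ExtV F ι :=
  π⁻¹ • ∑ j, ((A.map ((↑) : ℕ → F))⁻¹ j i) • contrE F j

/-- The element `E_{Aᵀ,1} E_{Aᵀ,2} ⋯ E_{Aᵀ,n} (1) ∈ ⋀(Fⁿ)`. -/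
def starTop (F : Type) [Field F] {ι : Type} [Fintype ι] [LinearOrder ι]
    (π : F) (A : Matrix ι ι ℕ) : ExtV F ι :=
  (Finset.univ.sort (· ≤ ·)).foldr (fun i v => EA F π Aᵀ i v)
    (Pi.single (∅ : Finset ι) (1 : F))

/-- Borisov's duality operator `*^A`, defined on the standard basis by
`*^A(e_{i_1} ∧ … ∧ e_{i_k}) = E^∨_{Aᵀ,i_1} ⋯ E^∨_{Aᵀ,i_k}(E_{Aᵀ,1} ⋯ E_{Aᵀ,n}(1))`. -/
def starA (F : Type) [Field F] {ι : Type} [Fintype ι] [LinearOrder ι]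
    (π : F) (A : Matrix ι ι ℕ) : ExtV F ι →ₗ[F] ExtV F ι :=
  (Pi.basisFun F (Finset ι)).constr F fun S =>
    (S.sort (· ≤ ·)).foldr (fun i v => EAdual F π Aᵀ i v) (starTop F π A)

/-- Index of a monomial `x^γ y^λ`. -/
abbrev MonIdx (ι : Type) := (ι → ℕ) × (ι → ℕ)

/-- The matrix `A` viewed over `ℚ`. -/
def Aq {ι : Type} [Fintype ι] [LinearOrder ι] (A : Matrix ι ι ℕ) : Matrix ι ι ℚ :=
  A.map ((↑) : ℕ → ℚ)

/-- The row vector `λ A⁻ᵀ`, computed over `ℚ`. -/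
def lamRow {ι : Type} [Fintype ι] [LinearOrder ι] (A : Matrix ι ι ℕ) (lam : ι → ℕ) :
    ι → ℚ :=
  Matrix.vecMul (fun i => (lam i : ℚ)) ((Aq A)ᵀ)⁻¹

/-- The row vector `γ A⁻¹`, computed over `ℚ`. -/
def gamRow {ι : Type} [Fintype ι] [LinearOrder ι] (A : Matrix ι ι ℕ) (gam : ι → ℕ) :
    ι → ℚ :=
  Matrix.vecMul (fun i => (gam i : ℚ)) (Aq A)⁻¹

/-- The allowed monomials `x^γ y^λ` of `R_A`: `(λA⁻ᵀ)_i ≥ 0` for all `i`, and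
`γ A⁻¹ λᵀ = 0`. -/
def OKA {ι : Type} [Fintype ι] [LinearOrder ι] (A : Matrix ι ι ℕ) (m : MonIdx ι) : Prop :=
  (∀ i, 0 ≤ lamRow A m.2 i) ∧ (gamRow A m.1 ⬝ᵥ fun i => ((m.2 i : ℚ))) = 0


/-- The allowed monomial indices of `R_A`. -/
abbrev AMon {n : ℕ} (A : Matrix (Fin n) (Fin n) ℕ) : Type := {m : MonIdx (Fin n) // OKA A m}

/-- Index set for coefficients of elements of `R_A ⊗ ⋀(Kⁿ)`. -/
abbrev BIdx {n : ℕ} (A : Matrix (Fin n) (Fin n) ℕ) : Type := AMon A × Finset (Fin n)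

/-- The full coefficient space of (possibly infinite) series supported on the allowed
monomials of `R_A`. -/
abbrev RFull (K : Type) {n : ℕ} (A : Matrix (Fin n) (Fin n) ℕ) : Type := AMon A → K

/-- The full coefficient space of (possibly infinite) series in `R_A ⊗ ⋀(Kⁿ)`. -/
abbrev BFull (K : Type) {n : ℕ} (A : Matrix (Fin n) (Fin n) ℕ) : Type := BIdx A → K

/-- Diagonal operator with weight `w`. -/
def diagOp {K : Type} [Field K] {α : Type} (w : α → K) : (α → K) →ₗ[K] (α → K) where
  toFun c a := w a * c a
  map_add' c c' := by funext a; simp [mul_add]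
  map_smul' r c := by funext a; simp [mul_left_comm]

/-- The "transpose" of a partially defined index map: `(pullOp σ c) b = c (σ b)`,
with the convention that missing values contribute `0`. -/
def pullOp {K : Type} [Field K] {α β : Type} (σ : β → Option α) :
    (α → K) →ₗ[K] (β → K) where
  toFun c b := ((σ b).map c).getD 0
  map_add' c c' := by funext b; cases h : σ b <;> simp [h]
  map_smul' r c := by funext b; cases h : σ b <;> simp [h]

/-- The tensor product `T ⊗ L` of a coefficientwise operator `T` on series and an
operator `L` on the (finite-dimensional) exterior algebra. -/
def tmap {K : Type} [Field K] {n : ℕ} {α β : Type}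
    (T : (α → K) →ₗ[K] (β → K)) (L : ExtV K (Fin n) →ₗ[K] ExtV K (Fin n)) :
    (α × Finset (Fin n) → K) →ₗ[K] (β × Finset (Fin n) → K) where
  toFun c q := ∑ S : Finset (Fin n), L (Pi.single S 1) q.2 * T (fun m => c (m, S)) q.1
  map_add' c c' := by
    funext q
    have h : ∀ S : Finset (Fin n), T (fun m => c (m, S) + c' (m, S))
        = T (fun m => c (m, S)) + T (fun m => c' (m, S)) := fun S =>
      map_add T (fun m => c (m, S)) (fun m => c' (m, S))
    simp only [Pi.add_apply]
    simp only [h, Pi.add_apply, mul_add, Finset.sum_add_distrib]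
  map_smul' r c := by
    funext q
    have h : ∀ S : Finset (Fin n), T (fun m => r * c (m, S))
        = r • T (fun m => c (m, S)) := fun S =>
      _root_.map_smul T r (fun m => c (m, S))
    simp only [Pi.smul_apply, smul_eq_mul, RingHom.id_apply]
    simp only [h, Pi.smul_apply, smul_eq_mul, Finset.mul_sum, mul_left_comm]

/-- `φ_{A,i} = π ∑_j A_{ji} x^{e_j A}·`, acting on coefficients of series. -/
def phiF (K : Type) [Field K] {n : ℕ} (π : K) (A : Matrix (Fin n) (Fin n) ℕ) (i : Fin n) :
    RFull K A →ₗ[K] RFull K A :=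
  π • ∑ j, (A j i : K) • pullOp (fun m' : AMon A =>
    if h : (∀ k, A j k ≤ m'.1.1 k) ∧ OKA A ((fun k => m'.1.1 k - A j k), m'.1.2)
    then some ⟨((fun k => m'.1.1 k - A j k), m'.1.2), h.2⟩ else none)

/-- `ψ^∨_{A,i} = y^{e_i Aᵀ}·`, acting on coefficients of series. -/
def psidualF (K : Type) [Field K] {n : ℕ} (A : Matrix (Fin n) (Fin n) ℕ) (i : Fin n) :
    RFull K A →ₗ[K] RFull K A :=
  pullOp (fun m' : AMon A =>
    if h : (∀ j, A j i ≤ m'.1.2 j) ∧ OKA A (m'.1.1, fun j => m'.1.2 j - A j i)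
    then some ⟨(m'.1.1, fun j => m'.1.2 j - A j i), h.2⟩ else none)

/-- `θ_{A,i} + φ_{A,i}`. -/
def dxF (K : Type) [Field K] {n : ℕ} (π : K) (A : Matrix (Fin n) (Fin n) ℕ) (i : Fin n) :
    RFull K A →ₗ[K] RFull K A :=
  diagOp (fun m => (m.1.1 i : K)) + phiF K π A i

/-- `T^∨_{A,i} + ψ^∨_{A,i}`. -/
def dyF (K : Type) [Field K] {n : ℕ} (π : K) (A : Matrix (Fin n) (Fin n) ℕ) (i : Fin n) :
    RFull K A →ₗ[K] RFull K A :=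
  diagOp (fun m => π⁻¹ * ((lamRow A m.1.2 i : ℚ) : K)) + psidualF K A i

/-- The differential `d_A + d^∨_A` on series. -/
def dFull (K : Type) [Field K] {n : ℕ} (π : K) (A : Matrix (Fin n) (Fin n) ℕ) :
    BFull K A →ₗ[K] BFull K A :=
  (∑ i, tmap (dxF K π A i) (mulE K i)) + ∑ i, tmap (dyF K π A i) (contrE K i)

/-- The total degree `|γ| + |λ|` of a monomial. -/
def degMon {n : ℕ} (m : MonIdx (Fin n)) : ℕ := (∑ i, m.1 i) + ∑ i, m.2 i

/-- Overconvergence (à la Dwork–Monsky) of a series: there is `M > 0` with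
`ord_p(coefficient) ≥ M(|γ|+|λ|)`, i.e. `‖coefficient‖ ≤ p^{-M(|γ|+|λ|)}`, for all but
finitely many monomials. -/
def OvercR {K : Type} [NontriviallyNormedField K] {n : ℕ} {A : Matrix (Fin n) (Fin n) ℕ}
    (p : ℕ) (c : RFull K A) : Prop :=
  ∃ M : ℝ, 0 < M ∧
    {m : AMon A | ¬ ‖c m‖ ≤ (p : ℝ) ^ (-(M * (degMon m.1 : ℝ)))}.Finite

/-- Overconvergence of an element of `B^†_A(K)`. -/
def OvercB {K : Type} [NontriviallyNormedField K] {n : ℕ} {A : Matrix (Fin n) (Fin n) ℕ}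
    (p : ℕ) (c : BFull K A) : Prop :=
  ∃ M : ℝ, 0 < M ∧
    {q : BIdx A | ¬ ‖c q‖ ≤ (p : ℝ) ^ (-(M * (degMon q.1.1 : ℝ)))}.Finite

/-- Polynomial (finitely supported) elements of `B_A(K)`. -/
def FinSuppB {K : Type} [Field K] {n : ℕ} {A : Matrix (Fin n) (Fin n) ℕ}
    (c : BFull K A) : Prop :=
  (Function.support c).Finite

/-- The condition `(γA⁻¹)_i ≥ 0` for all `i` cutting out `S_A ⊆ R_A`. -/
def gamOK {n : ℕ} (A : Matrix (Fin n) (Fin n) ℕ) (q : BIdx A) : Prop :=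
  ∀ i, 0 ≤ gamRow A q.1.1.1 i

/-- Membership in the subcomplex `C_A(K) = S_A(K) ⊗ ⋀(Kⁿ)` (polynomial version). -/
def CFin {K : Type} [Field K] {n : ℕ} {A : Matrix (Fin n) (Fin n) ℕ}
    (c : BFull K A) : Prop :=
  FinSuppB c ∧ ∀ q, c q ≠ 0 → gamOK A q

/-- Membership in the subcomplex `C^†_A(K) = S^†_A(K) ⊗ ⋀(Kⁿ)` (overconvergent
version). -/
def COver {K : Type} [NontriviallyNormedField K] {n : ℕ} {A : Matrix (Fin n) (Fin n) ℕ}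
    (p : ℕ) (c : BFull K A) : Prop :=
  OvercB p c ∧ ∀ q, c q ≠ 0 → gamOK A q

/-- The eigenvalue of `Q^∨_A = ∑ i, Q^∨_{A,i}` on the basis monomial indexed by `q`:
the number of `i ∉ S` with `(λA⁻ᵀ)_i ≠ 0`. -/
def qexpDual {n : ℕ} (A : Matrix (Fin n) (Fin n) ℕ) (q : BIdx A) : ℕ :=
  (Finset.univ.filter fun i => i ∉ q.2 ∧ lamRow A q.1.1.2 i ≠ 0).card

/-- The eigenvalue of `Q_A = ∑ i, Q_{A,i}` on the basis monomial indexed by `q`. -/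
def qexpQ {n : ℕ} (A : Matrix (Fin n) (Fin n) ℕ) (q : BIdx A) : ℕ :=
  q.2.card + qexpDual A q

/-- The diagonal operator `p^{Q_A}`. -/
def pQdiag (K : Type) [Field K] {n : ℕ} (p : ℕ) (A : Matrix (Fin n) (Fin n) ℕ) :
    BFull K A →ₗ[K] BFull K A :=
  diagOp fun q => (p : K) ^ (qexpQ A q)

/-- The diagonal operator `p^{Q^∨_A}`. -/
def pQdualdiag (K : Type) [Field K] {n : ℕ} (p : ℕ) (A : Matrix (Fin n) (Fin n) ℕ) :
    BFull K A →ₗ[K] BFull K A :=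
  diagOp fun q => (p : K) ^ (qexpDual A q)

/-- The diagonal operator `p^{Q_A + Q^∨_A}`. -/
def pQQdualdiag (K : Type) [Field K] {n : ℕ} (p : ℕ) (A : Matrix (Fin n) (Fin n) ℕ) :
    BFull K A →ₗ[K] BFull K A :=
  diagOp fun q => (p : K) ^ (qexpQ A q + qexpDual A q)

/-- The diagonal operator `p^{2·Q^∨_A}`. -/
def pQdual2diag (K : Type) [Field K] {n : ℕ} (p : ℕ) (A : Matrix (Fin n) (Fin n) ℕ) :
    BFull K A →ₗ[K] BFull K A :=
  diagOp fun q => (p : K) ^ (2 * qexpDual A q)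

/-- The diagonal operator `p^{2·ext − n}` (where `ext` is the exterior degree). -/
def pExtDiag (K : Type) [Field K] {n : ℕ} (p : ℕ) (A : Matrix (Fin n) (Fin n) ℕ) :
    BFull K A →ₗ[K] BFull K A :=
  diagOp fun q => (p : K) ^ (2 * (q.2.card : ℤ) - (n : ℤ))

/-- `Θ'_A : x^γ y^λ ↦ x^{pγ} y^{pλ}`, acting on coefficients of series. -/
def ThetaPrimeF (K : Type) [Field K] {n : ℕ} (p : ℕ) (A : Matrix (Fin n) (Fin n) ℕ) :
    RFull K A →ₗ[K] RFull K (p • A) :=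
  pullOp fun m' : AMon (p • A) =>
    if h : OKA A ((fun i => m'.1.1 i / p), (fun i => m'.1.2 i / p)) ∧
        (∀ i, p ∣ m'.1.1 i ∧ p ∣ m'.1.2 i)
    then some ⟨((fun i => m'.1.1 i / p), (fun i => m'.1.2 i / p)), h.1⟩ else none

/-- `Fr'_A = (Θ'_A ⊗ Id) ∘ p^{Q_A} : B^†_A(K) → B^†_{pA}(K)`. -/
def FrPrime (K : Type) [Field K] {n : ℕ} (p : ℕ)
    (A : Matrix (Fin n) (Fin n) ℕ) : BFull K A →ₗ[K] BFull K (p • A) :=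
  (tmap (ThetaPrimeF K p A) LinearMap.id).comp (pQdiag K p A)

/-- The coefficients of the Dwork exponential `exp(π(t^p − t)) = ∑ d_m t^m`:
`d_m = ∑_{a + pb = m} (−1)^a π^{a+b}/(a! b!)`. -/
def dworkCoef (K : Type) [Field K] (p : ℕ) (π : K) (m : ℕ) : K :=
  ∑ ab ∈ Finset.range (m + 1) ×ˢ Finset.range (m + 1),
    if ab.1 + p * ab.2 = m then
      ((-1 : K) ^ ab.1 * π ^ (ab.1 + ab.2)) / ((ab.1.factorial : K) * (ab.2.factorial : K))
    else 0

/-- The coefficient of `x^δ` in `Z_A(x) = exp(π(W_{pA}(x) − W_A(x)))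
= ∏_i exp(π((x^{e_iA})^p − x^{e_iA}))`. -/
def Zcoef (K : Type) [Field K] {n : ℕ} (p : ℕ) (π : K) (A : Matrix (Fin n) (Fin n) ℕ)
    (δ : Fin n → ℕ) : K :=
  ∑ k ∈ Fintype.piFinset (fun _ : Fin n => Finset.range ((∑ j, δ j) + 1)),
    if ∀ j, (∑ i, k i * A i j) = δ j then ∏ i, dworkCoef K p π (k i) else 0

/-- `Θ''_A`: multiplication by `Z_A(x) Z_{Aᵀ}(y)`, as a map `R^†_{pA}(K) → R^†_A(K)`
(computed on coefficients; monomials violating the support conditions are set to `0`). -/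
def ZmulF (K : Type) [Field K] {n : ℕ} (p : ℕ) (π : K) (A : Matrix (Fin n) (Fin n) ℕ) :
    RFull K (p • A) →ₗ[K] RFull K A where
  toFun c m' :=
    ∑ δ ∈ Fintype.piFinset (fun _ : Fin n => Finset.range ((∑ j, m'.1.1 j) + 1)),
      ∑ ε ∈ Fintype.piFinset (fun _ : Fin n => Finset.range ((∑ j, m'.1.2 j) + 1)),
        Zcoef K p π A δ * Zcoef K p π Aᵀ ε *
          (if h : (∀ k, δ k ≤ m'.1.1 k) ∧ (∀ k, ε k ≤ m'.1.2 k) ∧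
              OKA (p • A) ((fun k => m'.1.1 k - δ k), (fun k => m'.1.2 k - ε k))
          then c ⟨((fun k => m'.1.1 k - δ k), (fun k => m'.1.2 k - ε k)), h.2.2⟩ else 0)
  map_add' c c' := by
    funext m'
    have key : ∀ (P : Prop) (hP : Decidable P) (f g : P → K),
        (dite P (fun h => f h + g h) (fun _ => (0 : K)))
          = dite P f (fun _ => 0) + dite P g (fun _ => 0) := by
      intro P hP f g; split <;> simp
    simp only [Pi.add_apply, key, mul_add, Finset.sum_add_distrib]
  map_smul' r c := by
    funext m'
    have key : ∀ (P : Prop) (hP : Decidable P) (f : P → K),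
        (dite P (fun h => r * f h) (fun _ => (0 : K))) = r * dite P f (fun _ => 0) := by
      intro P hP f; split <;> simp
    simp only [Pi.smul_apply, smul_eq_mul, RingHom.id_apply, key, Finset.mul_sum,
      mul_left_comm]

/-- `Fr''_A = (Θ''_A ⊗ Id) ∘ p^{Q^∨_{pA}} : B^†_{pA}(K) → B^†_A(K)`. -/
def FrDoublePrime (K : Type) [Field K] {n : ℕ} (p : ℕ) (π : K)
    (A : Matrix (Fin n) (Fin n) ℕ) : BFull K (p • A) →ₗ[K] BFull K A :=
  (tmap (ZmulF K p π A) LinearMap.id).comp (pQdualdiag K p (p • A))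

/-- The Frobenius endomorphism `Fr_A = ((Θ''_A ∘ Θ'_A) ⊗ Id) ∘ p^{Q_A + Q^∨_A}`. -/
def FrFull (K : Type) [Field K] {n : ℕ} (p : ℕ) (π : K)
    (A : Matrix (Fin n) (Fin n) ℕ) : BFull K A →ₗ[K] BFull K A :=
  (tmap ((ZmulF K p π A).comp (ThetaPrimeF K p A)) LinearMap.id).comp (pQQdualdiag K p A)

/-- The transposition map `D^A : x^γ y^λ ↦ x^λ y^γ` on coefficients of series. -/
def DAmapF (K : Type) [Field K] {n : ℕ} (A : Matrix (Fin n) (Fin n) ℕ) :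
    RFull K A →ₗ[K] RFull K Aᵀ :=
  pullOp fun m' : AMon Aᵀ =>
    if h : OKA A (m'.1.2, m'.1.1) then some ⟨(m'.1.2, m'.1.1), h⟩ else none

/-- Berglund–Hübsch duality `Δ^A = D^A ⊗ *^A` on series. -/
def DeltaF (K : Type) [Field K] {n : ℕ} (π : K) (A : Matrix (Fin n) (Fin n) ℕ) :
    BFull K A →ₗ[K] BFull K Aᵀ :=
  tmap (DAmapF K A) (starA K π A)

/-- `Q̂_{A,i} = P̂_{A,i} ⊗ E_{A,i} E^∨_{A,i}` (the projection `P̂_{A,i}` is onto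
monomials with `(γA⁻¹)_i ≠ 0`). -/
def QhatFull (K : Type) [Field K] {n : ℕ} (π : K) (A : Matrix (Fin n) (Fin n) ℕ)
    (i : Fin n) : BFull K A →ₗ[K] BFull K A :=
  tmap (diagOp fun m : AMon A => if gamRow A m.1.1 i = 0 then (0 : K) else 1)
    ((EA K π A i).comp (EAdual K π A i))

/-- `p^{−2Q̂_A} = ∏_i (Id + (p⁻² − 1) Q̂_{A,i})` (the `Q̂_{A,i}` are commuting
idempotents). -/
def pQhatInvDiag (K : Type) [Field K] {n : ℕ} (p : ℕ) (π : K)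
    (A : Matrix (Fin n) (Fin n) ℕ) : BFull K A →ₗ[K] BFull K A :=
  ((List.finRange n).map fun i =>
    LinearMap.id + ((p : K) ^ (-2 : ℤ) - 1) • QhatFull K π A i).foldr
    (fun f g => f.comp g) LinearMap.id

/-- `#_A`: the number of indices `i` with `(γA⁻¹)_i ∉ ℤ`. -/
def hashA {n : ℕ} (A : Matrix (Fin n) (Fin n) ℕ) (q : BIdx A) : ℤ :=
  ((Finset.univ.filter fun i => ¬ ∃ z : ℤ, gamRow A q.1.1.1 i = (z : ℚ)).card : ℤ)

/-- `#^∨_A`: the number of indices `i` with `(λA⁻ᵀ)_i ∉ ℤ`. -/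
def hashAdual {n : ℕ} (A : Matrix (Fin n) (Fin n) ℕ) (q : BIdx A) : ℤ :=
  ((Finset.univ.filter fun i => ¬ ∃ z : ℤ, lamRow A q.1.1.2 i = (z : ℚ)).card : ℤ)

/-- The diagonal twist `(κπ)^{(p−1)(#_A − #^∨_A)/2}`. -/
def TwistDiag (K : Type) [Field K] {n : ℕ} (p : ℕ) (κ π : K)
    (A : Matrix (Fin n) (Fin n) ℕ) : BFull K A →ₗ[K] BFull K A :=
  diagOp fun q => (κ * π) ^ ((((p : ℤ) - 1) / 2) * (hashA A q - hashAdual A q))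

/-- The twisted Frobenius `TFr_A = Fr_A ∘ (κπ)^{(p−1)(#_A − #^∨_A)/2}`. -/
def TFrFull (K : Type) [Field K] {n : ℕ} (p : ℕ) (κ π : K)
    (A : Matrix (Fin n) (Fin n) ℕ) : BFull K A →ₗ[K] BFull K A :=
  (FrFull K p π A).comp (TwistDiag K p κ π A)
end

section DworkSeries

open PowerSeries

/-- The Euler operator `X · d/dX` on power series. -/
noncomputable def eulerPS {F : Type} [Field F] (f : PowerSeries F) : PowerSeries F :=
  PowerSeries.mk fun m => (m : F) * coeff m f

lemma coeff_eulerPS {F : Type} [Field F] (f : PowerSeries F) (m : ℕ) :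
    coeff m (eulerPS f) = (m : F) * coeff m f := by
  simp [eulerPS]

lemma eulerPS_mul {F : Type} [Field F] (f g : PowerSeries F) :
    eulerPS (f * g) = eulerPS f * g + f * eulerPS g := by
  ext m
  simp only [coeff_eulerPS, map_add, coeff_mul, Finset.mul_sum, ← Finset.sum_add_distrib]
  refine Finset.sum_congr rfl fun q hq => ?_
  have h : q.1 + q.2 = m := Finset.HasAntidiagonal.mem_antidiagonal.1 hq
  rw [← h]
  push_cast
  ring

lemma eulerPS_one {F : Type} [Field F] : eulerPS (1 : PowerSeries F) = 0 := by
  ext m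
  rw [coeff_eulerPS, coeff_one]
  split_ifs with h <;> simp [h]

/-- Uniqueness for the equation `X df/dX = P f` when `P` has no constant term. -/
lemma eq_of_eulerPS_eq_mul {F : Type} [Field F] [CharZero F] {P f g : PowerSeries F}
    (hP : coeff 0 P = 0) (hf : eulerPS f = P * f) (hg : eulerPS g = P * g)
    (h0 : coeff 0 f = coeff 0 g) : f = g := by
  ext m
  induction m using Nat.strong_induction_on with
  | _ m ih =>
    rcases Nat.eq_zero_or_pos m with rfl | hm
    · exact h0
    · have hfm := congrArg (coeff m) hf
      have hgm := congrArg (coeff m) hg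
      rw [coeff_eulerPS, coeff_mul] at hfm hgm
      have hs : ∑ q ∈ Finset.HasAntidiagonal.antidiagonal m, coeff q.1 P * coeff q.2 f
          = ∑ q ∈ Finset.HasAntidiagonal.antidiagonal m, coeff q.1 P * coeff q.2 g := by
        refine Finset.sum_congr rfl fun q hq => ?_
        have h : q.1 + q.2 = m := Finset.HasAntidiagonal.mem_antidiagonal.1 hq
        rcases Nat.eq_zero_or_pos q.1 with h1 | h1
        · rw [h1, hP, zero_mul, zero_mul]
        · rw [ih q.2 (by omega)]
      rw [hs, ← hgm] at hfm
      exact mul_left_cancel₀ (Nat.cast_ne_zero.2 hm.ne') hfm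

/-- The series `exp(c X^k)`. -/
noncomputable def expMon {F : Type} [Field F] (c : F) (k : ℕ) : PowerSeries F :=
  PowerSeries.mk fun m => if k ∣ m then c ^ (m / k) / ((m / k).factorial : F) else 0

lemma coeff_zero_expMon {F : Type} [Field F] (c : F) (k : ℕ) : coeff 0 (expMon c k) = 1 := by
  simp [expMon]

lemma eulerPS_expMon {F : Type} [Field F] [CharZero F] (c : F) {k : ℕ} (hk : 0 < k) :
    eulerPS (expMon c k) = (C (c * k) * X ^ k) * expMon c k := by
  ext m
  rw [coeff_eulerPS, mul_assoc, coeff_C_mul, coeff_X_pow_mul']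
  simp only [expMon, coeff_mk]
  by_cases hd : k ∣ m
  · obtain ⟨j, rfl⟩ := hd
    rcases j with _ | j
    · simp [hk.ne']
    · have h1 : k ≤ k * (j + 1) := Nat.le_mul_of_pos_right _ (Nat.succ_pos _)
      have h2 : k * (j + 1) - k = k * j := by rw [Nat.mul_succ]; omega
      rw [if_pos (dvd_mul_right _ _), if_pos h1, h2, if_pos (dvd_mul_right _ _),
        Nat.mul_div_cancel_left _ hk, Nat.mul_div_cancel_left _ hk, Nat.factorial_succ]
      have h3 : ((j.factorial : ℕ) : F) ≠ 0 := Nat.cast_ne_zero.2 (Nat.factorial_ne_zero j)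
      have h4 : ((j : F) + 1) ≠ 0 := by exact_mod_cast Nat.succ_ne_zero j
      push_cast
      field_simp
      ring
  · rw [if_neg hd, mul_zero]
    by_cases hm : k ≤ m
    · rw [if_pos hm, if_neg, mul_zero]
      intro h
      exact hd ((Nat.dvd_sub_iff_left hm dvd_rfl).1 h)
    · rw [if_neg hm, mul_zero]

lemma coeff_zero_prod_expMon {F : Type} [Field F] (c : ℕ → F) (s : Finset ℕ) :
    coeff 0 (∏ k ∈ s, expMon (c k) k) = 1 := by
  rw [coeff_zero_eq_constantCoeff_apply, map_prod]
  refine Finset.prod_eq_one fun k _ => ?_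
  rw [← coeff_zero_eq_constantCoeff_apply, coeff_zero_expMon]

lemma eulerPS_prod_expMon {F : Type} [Field F] [CharZero F] (c : ℕ → F) (s : Finset ℕ)
    (hs : ∀ k ∈ s, 0 < k) :
    eulerPS (∏ k ∈ s, expMon (c k) k)
      = (∑ k ∈ s, C (c k * k) * X ^ k) * ∏ k ∈ s, expMon (c k) k := by
  induction s using Finset.induction_on with
  | empty => simp [eulerPS_one]
  | insert a s ha ih =>
    rw [Finset.prod_insert ha, Finset.sum_insert ha, eulerPS_mul,
      ih fun k hk => hs k (Finset.mem_insert_of_mem hk),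
      eulerPS_expMon _ (hs a (Finset.mem_insert_self _ _))]
    ring

lemma mk_dworkCoef {F : Type} [Field F] {p : ℕ} (hp : 0 < p) (π : F) :
    PowerSeries.mk (dworkCoef F p π) = expMon (-π) 1 * expMon π p := by
  ext m
  rw [coeff_mk, coeff_mul, dworkCoef, ← Finset.sum_filter]
  have hR : ∑ q ∈ Finset.HasAntidiagonal.antidiagonal m,
      coeff q.1 (expMon (-π) 1) * coeff q.2 (expMon π p)
      = ∑ q ∈ (Finset.HasAntidiagonal.antidiagonal m).filter (fun q => p ∣ q.2),
        coeff q.1 (expMon (-π) 1) * coeff q.2 (expMon π p) := by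
    rw [Finset.sum_filter]
    refine Finset.sum_congr rfl fun q _ => ?_
    split_ifs with h
    · rfl
    · simp [expMon, h]
  rw [hR]
  refine Finset.sum_bij' (fun ab _ => (ab.1, p * ab.2)) (fun q _ => (q.1, q.2 / p)) ?_ ?_ ?_ ?_ ?_
  · rintro ⟨a, b⟩ h
    simp only [Finset.mem_filter, Finset.HasAntidiagonal.mem_antidiagonal] at h ⊢
    exact ⟨h.2, dvd_mul_right _ _⟩
  · rintro ⟨a, b⟩ h
    simp only [Finset.mem_filter, Finset.HasAntidiagonal.mem_antidiagonal, Finset.mem_product,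
      Finset.mem_range] at h ⊢
    have := Nat.div_le_self b p
    refine ⟨⟨by omega, by omega⟩, ?_⟩
    rw [Nat.mul_div_cancel' h.2, h.1]
  · rintro ⟨a, b⟩ h
    simp [Nat.mul_div_cancel_left _ hp]
  · rintro ⟨a, b⟩ h
    simp only [Finset.mem_filter] at h
    simp [Nat.mul_div_cancel' h.2]
  · rintro ⟨a, b⟩ h
    simp only [expMon, coeff_mk, one_dvd, if_true, Nat.div_one, dvd_mul_right,
      Nat.mul_div_cancel_left _ hp]
    rw [neg_pow π, div_mul_div_comm, pow_add, mul_assoc]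

lemma eulerPS_mk_dworkCoef {F : Type} [Field F] [CharZero F] {p : ℕ} (hp : 0 < p) (π : F) :
    eulerPS (PowerSeries.mk (dworkCoef F p π))
      = (C (π * p) * X ^ p - C π * X) * PowerSeries.mk (dworkCoef F p π) := by
  rw [mk_dworkCoef hp, eulerPS_mul, eulerPS_expMon _ hp, eulerPS_expMon _ one_pos]
  simp only [Nat.cast_one, mul_one, pow_one, map_neg]
  ring

/-- The recurrence satisfied by the coefficients of `exp(π(t^p - t))`. -/
lemma dworkCoef_recurrence {F : Type} [Field F] [CharZero F] {p : ℕ} (hp : 0 < p) (π : F)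
    (m : ℕ) :
    (m : F) * dworkCoef F p π m
      = π * (p * (if p ≤ m then dworkCoef F p π (m - p) else 0)
        - if 1 ≤ m then dworkCoef F p π (m - 1) else 0) := by
  have h := congrArg (coeff m) (eulerPS_mk_dworkCoef hp π)
  rw [coeff_eulerPS, sub_mul, mul_assoc, mul_assoc, map_sub, coeff_C_mul, coeff_C_mul,
    coeff_X_pow_mul', ← pow_one (X : PowerSeries F), coeff_X_pow_mul'] at h
  simp only [coeff_mk] at h
  rw [h]
  ring

/-- The truncated product `∏_{1 ≤ k ≤ N} exp(-(πX)^k / k)` agrees with `1 - πX` up to degree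
`N`. -/
lemma coeff_prod_expMon_eq_zero {F : Type} [Field F] [CharZero F] (π : F) (N j : ℕ)
    (hj : 2 ≤ j) (hjN : j ≤ N) :
    coeff j (∏ k ∈ Finset.Icc 1 N, expMon (-(π ^ k / (k : F))) k) = 0 := by
  set U := ∏ k ∈ Finset.Icc 1 N, expMon (-(π ^ k / (k : F))) k with hU
  have hE : eulerPS U = (∑ k ∈ Finset.Icc 1 N, -(C π * X) ^ k) * U := by
    rw [hU, eulerPS_prod_expMon (fun k => -(π ^ k / (k : F))) _
      fun k hk => (Finset.mem_Icc.1 hk).1]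
    congr 1
    refine Finset.sum_congr rfl fun k hk => ?_
    have h1 : (k : F) ≠ 0 := Nat.cast_ne_zero.2 (Nat.pos_iff_ne_zero.1 (Finset.mem_Icc.1 hk).1)
    rw [mul_pow, ← map_pow, neg_mul, div_mul_cancel₀ _ h1, map_neg, neg_mul]
  have hG : (1 - C π * X) * (∑ k ∈ Finset.Icc 1 N, -(C π * X : PowerSeries F) ^ k)
      = -(C π * X) + (C π * X) ^ (N + 1) := by
    clear_value U
    clear hE hU hjN
    induction N with
    | zero => simp
    | succ N ih =>
      rw [Finset.sum_Icc_succ_top (by omega), mul_add, ih]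
      ring
  have hR : (1 - C π * X) * eulerPS U = (-(C π * X) + (C π * X) ^ (N + 1)) * U := by
    rw [hE, ← mul_assoc, hG]
  have hstep : ∀ i, i + 1 ≤ N →
      ((i : F) + 1) * coeff (i + 1) U = π * ((i : F) - 1) * coeff i U := by
    intro i hi
    have h := congrArg (coeff (i + 1)) hR
    rw [sub_mul, one_mul, add_mul, neg_mul, map_sub, map_add, map_neg, mul_assoc, mul_assoc,
      coeff_C_mul, coeff_C_mul, coeff_succ_X_mul, coeff_succ_X_mul, mul_pow, ← map_pow,
      mul_assoc, coeff_C_mul, coeff_X_pow_mul', if_neg (by omega), coeff_eulerPS,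
      coeff_eulerPS] at h
    push_cast at h
    linear_combination h
  induction j, hj using Nat.le_induction with
  | base =>
    have h := hstep 1 hjN
    norm_num at h
    exact h
  | succ i hi ih =>
    have h := hstep i hjN
    rw [ih (by omega), mul_zero] at h
    have h4 : ((i : F) + 1) ≠ 0 := by exact_mod_cast Nat.succ_ne_zero i
    exact (mul_eq_zero.1 h).resolve_left h4

lemma coeff_one_prod_expMon {F : Type} [Field F] [CharZero F] (π : F) (N : ℕ) (hN : 1 ≤ N) :
    coeff 1 (∏ k ∈ Finset.Icc 1 N, expMon (-(π ^ k / (k : F))) k) = -π := by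
  have h := congrArg (coeff 1) (eulerPS_prod_expMon (fun k => -(π ^ k / (k : F)))
    (Finset.Icc 1 N) fun k hk => (Finset.mem_Icc.1 hk).1)
  rw [coeff_eulerPS, coeff_mul, Finset.Nat.antidiagonal_succ] at h
  simp only [Finset.Nat.antidiagonal_zero, Finset.map_singleton, Finset.sum_cons,
    Finset.sum_singleton, Function.Embedding.prodMap, Function.Embedding.coeFn_mk, Prod.map,
    map_sum, coeff_C_mul, coeff_X_pow] at h
  have h0 : ∑ k ∈ Finset.Icc 1 N, -(π ^ k / (k : F)) * (k : F) * (if 0 = k then 1 else 0) = 0 := by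
    refine Finset.sum_eq_zero fun k hk => ?_
    rw [if_neg (Nat.pos_iff_ne_zero.1 (Finset.mem_Icc.1 hk).1).symm, mul_zero]
  have h1 : ∑ k ∈ Finset.Icc 1 N, -(π ^ k / (k : F)) * (k : F) * (if 1 = k then 1 else 0)
      = -π := by
    rw [Finset.sum_eq_single 1]
    · simp
    · intro k _ hk
      rw [if_neg (Ne.symm hk), mul_zero]
    · intro h
      exact absurd (Finset.mem_Icc.2 ⟨le_rfl, hN⟩) h
  simp only [Nat.succ_eq_add_one, zero_add, Function.Embedding.refl_apply] at h
  erw [h0, h1, coeff_zero_prod_expMon] at h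
  simpa using h

/-- The comparison of `exp(π(X^p - X))` with `1 / (1 - πX)`, in truncated form. -/
lemma mk_dworkCoef_eq_prod {F : Type} [Field F] [CharZero F] {p : ℕ} (hp : 2 ≤ p) {π : F}
    (hπ : π ^ (p - 1) = -(p : F)) (N : ℕ) (hN : p ≤ N) :
    PowerSeries.mk (dworkCoef F p π)
      = (∏ k ∈ Finset.Icc 1 N, expMon (-(π ^ k / (k : F))) k)
        * ∏ k ∈ ((Finset.Icc 1 N).erase 1).erase p, expMon (π ^ k / (k : F)) k := by
  have hp1 : 1 ∈ Finset.Icc 1 N := Finset.mem_Icc.2 ⟨le_rfl, by omega⟩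
  have hpp : p ∈ (Finset.Icc 1 N).erase 1 :=
    Finset.mem_erase.2 ⟨by omega, Finset.mem_Icc.2 ⟨by omega, hN⟩⟩
  have hπp : π ^ p = -(p * π) := by
    obtain ⟨r, rfl⟩ : ∃ r, p = r + 1 := ⟨p - 1, by omega⟩
    rw [Nat.add_sub_cancel] at hπ
    rw [pow_succ, hπ, neg_mul]
  refine eq_of_eulerPS_eq_mul ?_ (eulerPS_mk_dworkCoef (by omega) π) ?_ ?_
  · have hX : coeff 0 (X ^ p : PowerSeries F) = 0 := by
      rw [coeff_X_pow, if_neg (by omega)]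
    rw [map_sub, coeff_C_mul, coeff_C_mul, hX]
    simp
  · rw [eulerPS_mul, eulerPS_prod_expMon (fun k => -(π ^ k / (k : F))) _
      fun k hk => (Finset.mem_Icc.1 hk).1, eulerPS_prod_expMon (fun k => π ^ k / (k : F)) _
      fun k hk => (Finset.mem_Icc.1 (Finset.mem_of_mem_erase (Finset.mem_of_mem_erase hk))).1]
    rw [← Finset.add_sum_erase _ _ hp1, ← Finset.add_sum_erase _ _ hpp]
    have hs : ∑ k ∈ ((Finset.Icc 1 N).erase 1).erase p,
          C (-(π ^ k / (k : F)) * (k : F)) * X ^ k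
        = -∑ k ∈ ((Finset.Icc 1 N).erase 1).erase p, C (π ^ k / (k : F) * (k : F)) * X ^ k := by
      rw [← Finset.sum_neg_distrib]
      refine Finset.sum_congr rfl fun k _ => ?_
      rw [neg_mul, map_neg, neg_mul]
    have hpF : (p : F) ≠ 0 := Nat.cast_ne_zero.2 (by omega)
    rw [hs, neg_mul (π ^ p / (p : F)), div_mul_cancel₀ _ hpF, hπp]
    simp only [Nat.cast_one, pow_one, div_one, mul_one, neg_neg, map_neg, mul_comm π (p : F)]
    ring
  · rw [coeff_mk, coeff_mul, Finset.Nat.antidiagonal_zero, Finset.sum_singleton,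
      coeff_zero_prod_expMon (fun k => -(π ^ k / (k : F))),
      coeff_zero_prod_expMon (fun k => π ^ k / (k : F))]
    have hp0 : p ≠ 0 := by omega
    simp [dworkCoef]

end DworkSeries

section DworkEstimate

open PowerSeries

lemma norm_natCast_eq_inv_pow_padicValNat {K : Type} [NontriviallyNormedField K]
    [IsUltrametricDist K] {p : ℕ} [hp : Fact p.Prime] (hpnorm : ‖(p : K)‖ = (p : ℝ)⁻¹)
    {k : ℕ} (hk : k ≠ 0) : ‖(k : K)‖ = ((p : ℝ)⁻¹) ^ padicValNat p k := by
  have hp1 : (1 : ℝ) < p := by exact_mod_cast hp.out.one_lt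
  have hcop : ∀ u : ℕ, ¬ p ∣ u → ‖(u : K)‖ = 1 := by
    intro u hu
    refine le_antisymm (IsUltrametricDist.norm_natCast_le_one K u) ?_
    by_contra hlt
    have hco : IsCoprime (u : ℤ) (p : ℤ) :=
      Nat.isCoprime_iff_coprime.2 ((hp.out.coprime_iff_not_dvd.2 hu).symm)
    obtain ⟨a, b, hab⟩ := hco
    have habK : (a : K) * (u : K) + (b : K) * (p : K) = 1 := by
      exact_mod_cast congrArg (Int.cast : ℤ → K) hab
    have h1 : ‖(a : K) * (u : K)‖ < 1 := by
      rw [norm_mul]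
      exact lt_of_le_of_lt (mul_le_of_le_one_left (norm_nonneg _)
        (IsUltrametricDist.norm_intCast_le_one K a)) (not_le.1 hlt)
    have h2 : ‖(b : K) * (p : K)‖ < 1 := by
      rw [norm_mul, hpnorm]
      exact lt_of_le_of_lt (mul_le_of_le_one_left (by positivity)
        (IsUltrametricDist.norm_intCast_le_one K b)) (inv_lt_one_of_one_lt₀ hp1)
    have h3 := IsUltrametricDist.norm_add_le_max ((a : K) * (u : K)) ((b : K) * (p : K))
    rw [habK, norm_one] at h3
    exact absurd h3 (not_le.2 (max_lt h1 h2))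
  obtain ⟨u, hu⟩ : p ^ padicValNat p k ∣ k := pow_padicValNat_dvd
  have hu' : ¬ p ∣ u := by
    rintro ⟨w, rfl⟩
    refine pow_succ_padicValNat_not_dvd (p := p) hk ⟨w, ?_⟩
    rw [pow_succ, mul_assoc]
    exact hu
  conv_lhs => rw [hu]
  rw [Nat.cast_mul, Nat.cast_pow, norm_mul, norm_pow, hpnorm, hcop u hu', mul_one]

lemma add_sq_mul_padicValNat_le {p : ℕ} [hp : Fact p.Prime] {k : ℕ} (hk : 2 ≤ k) (hkp : k ≠ p) :
    k + p ^ 2 * ((p - 1) * padicValNat p k + 1) ≤ p ^ 2 * k := by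
  obtain ⟨q, rfl⟩ : ∃ q, p = q + 2 := ⟨p - 2, by have := hp.out.two_le; omega⟩
  obtain ⟨u, hu⟩ : (q + 2) ^ padicValNat (q + 2) k ∣ k := pow_padicValNat_dvd
  generalize padicValNat (q + 2) k = v at hu ⊢
  have hu0 : 1 ≤ u := by
    rcases Nat.eq_zero_or_pos u with rfl | h
    · omega
    · exact h
  have hq : q + 2 - 1 = q + 1 := by omega
  rw [hq]
  rcases v with _ | _ | v
  · have h4 : 4 ≤ (q + 2) ^ 2 := by nlinarith
    nlinarith
  · have hu1 : u ≠ 1 := by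
      rintro rfl
      apply hkp
      simpa using hu
    obtain ⟨t, rfl⟩ : ∃ t, u = t + 2 := ⟨u - 2, by omega⟩
    rw [hu]
    ring_nf
    nlinarith [Nat.zero_le (q * t), Nat.zero_le (q ^ 2 * t), Nat.zero_le (q ^ 3 * t)]
  · have hv : v + 3 ≤ (q + 3) * (q + 2) ^ v := by
      clear hu
      induction v with
      | zero => simp
      | succ v ih =>
        rw [pow_succ]
        nlinarith [Nat.zero_le (q * ((q + 3) * (q + 2) ^ v))]
    have hmain : (q + 1) * (v + 2) + 1 ≤ (q + 1) * ((q + 3) * (q + 2) ^ v) :=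
      le_trans (by nlinarith) (Nat.mul_le_mul_left (q + 1) hv)
    have hmain2 : (q + 1) * (v + 2) + 1 ≤ (q + 1) * ((q + 3) * (q + 2) ^ v) * u :=
      le_trans hmain (Nat.le_mul_of_pos_right _ hu0)
    have hk' : k = (q + 2) ^ 2 * ((q + 2) ^ v * u) := by
      rw [hu]; ring
    calc k + (q + 2) ^ 2 * ((q + 1) * (v + 1 + 1) + 1)
        ≤ k + (q + 2) ^ 2 * ((q + 1) * ((q + 3) * (q + 2) ^ v) * u) := by gcongr
      _ = (q + 2) ^ 2 * k := by rw [hk']; ring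

lemma norm_coeff_mul_le_pow {K : Type} [NontriviallyNormedField K] [IsUltrametricDist K]
    {r : ℝ} (hr : 0 ≤ r) {f g : PowerSeries K} (N : ℕ) (hf : ∀ m ≤ N, ‖coeff m f‖ ≤ r ^ m)
    (hg : ∀ m ≤ N, ‖coeff m g‖ ≤ r ^ m) : ∀ m ≤ N, ‖coeff m (f * g)‖ ≤ r ^ m := by
  intro m hm
  rw [coeff_mul]
  refine IsUltrametricDist.norm_sum_le_of_forall_le_of_nonneg (by positivity) fun q hq => ?_
  have h : q.1 + q.2 = m := Finset.HasAntidiagonal.mem_antidiagonal.1 hq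
  rw [norm_mul, ← h, pow_add]
  exact mul_le_mul (hf _ (by omega)) (hg _ (by omega)) (norm_nonneg _) (by positivity)

lemma norm_coeff_prod_le_pow {K : Type} [NontriviallyNormedField K] [IsUltrametricDist K]
    {r : ℝ} (hr : 0 ≤ r) (f : ℕ → PowerSeries K) (s : Finset ℕ) (N : ℕ)
    (hf : ∀ k ∈ s, ∀ m ≤ N, ‖coeff m (f k)‖ ≤ r ^ m) :
    ∀ m ≤ N, ‖coeff m (∏ k ∈ s, f k)‖ ≤ r ^ m := by
  induction s using Finset.induction_on with
  | empty =>
    intro m _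
    rw [Finset.prod_empty, coeff_one]
    split_ifs with h
    · simp [h]
    · rw [norm_zero]; positivity
  | insert a s ha ih =>
    rw [Finset.prod_insert ha]
    exact norm_coeff_mul_le_pow hr N (hf a (Finset.mem_insert_self _ _))
      (ih fun k hk => hf k (Finset.mem_insert_of_mem hk))

lemma norm_coeff_expMon_le {K : Type} [NontriviallyNormedField K] [CharZero K]
    [IsUltrametricDist K] {p : ℕ} [hp : Fact p.Prime] (hpnorm : ‖(p : K)‖ = (p : ℝ)⁻¹)
    {π : K} (hπ : π ^ (p - 1) = -(p : K)) {r : ℝ} (hr0 : 0 < r) (hr1 : r < 1)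
    (hr : r ^ (p ^ 2) = ‖π‖) {k : ℕ} (hk : 2 ≤ k) (hkp : k ≠ p) (m : ℕ) :
    ‖coeff m (expMon (π ^ k / (k : K)) k)‖ ≤ r ^ m := by
  rw [expMon, coeff_mk]
  split_ifs with hd
  swap
  · rw [norm_zero]; positivity
  obtain ⟨j, rfl⟩ := hd
  rw [Nat.mul_div_cancel_left _ (by omega)]
  have hw : (p : ℝ)⁻¹ = r ^ (p ^ 2 * (p - 1)) := by
    rw [pow_mul, hr, ← norm_pow, hπ, norm_neg, hpnorm]
  have hj : (p - 1) * padicValNat p j.factorial ≤ j := by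
    rw [sub_one_mul_padicValNat_factorial]
    exact Nat.sub_le _ _
  rw [norm_div, norm_pow, norm_div, norm_pow,
    norm_natCast_eq_inv_pow_padicValNat hpnorm (by omega : k ≠ 0),
    norm_natCast_eq_inv_pow_padicValNat hpnorm (Nat.factorial_ne_zero j), hw, ← hr, div_pow,
    div_div, div_le_iff₀ (by positivity)]
  simp only [← pow_mul, ← pow_add]
  refine pow_le_pow_of_le_one hr0.le hr1.le ?_
  have h1 := add_sq_mul_padicValNat_le (p := p) hk hkp
  generalize padicValNat p k = v at h1 ⊢
  generalize padicValNat p j.factorial = w at hj ⊢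
  calc k * j + (p ^ 2 * (p - 1) * v * j + p ^ 2 * (p - 1) * w)
      = k * j + (p ^ 2 * (p - 1) * v * j + p ^ 2 * ((p - 1) * w)) := by ring
    _ ≤ k * j + (p ^ 2 * (p - 1) * v * j + p ^ 2 * j) := by gcongr
    _ = (k + p ^ 2 * ((p - 1) * v + 1)) * j := by ring
    _ ≤ p ^ 2 * k * j := by gcongr
    _ = p ^ 2 * k * j := rfl

/-- Dwork's estimate: the coefficients of `exp(π(t^p - t))` decay geometrically. -/
lemma exists_norm_dworkCoef_le_pow {K : Type} [NontriviallyNormedField K] [CharZero K]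
    [IsUltrametricDist K] {p : ℕ} [hp : Fact p.Prime] (hpnorm : ‖(p : K)‖ = (p : ℝ)⁻¹)
    {π : K} (hπ : π ^ (p - 1) = -(p : K)) :
    ∃ r : ℝ, 0 < r ∧ r < 1 ∧ ∀ m, ‖dworkCoef K p π m‖ ≤ r ^ m := by
  have hp2 : 2 ≤ p := hp.out.two_le
  have hp1 : (1 : ℝ) < p := by exact_mod_cast hp.out.one_lt
  have hw : ‖π‖ ^ (p - 1) = (p : ℝ)⁻¹ := by rw [← norm_pow, hπ, norm_neg, hpnorm]
  have hw0 : 0 < ‖π‖ := by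
    refine lt_of_le_of_ne (norm_nonneg _) fun h => ?_
    rw [← h, zero_pow (by omega)] at hw
    have : 0 < (p : ℝ)⁻¹ := by positivity
    linarith
  have hw1 : ‖π‖ < 1 := by
    by_contra h
    have h1 := one_le_pow₀ (n := p - 1) (not_lt.1 h)
    rw [hw] at h1
    exact absurd h1 (not_le.2 (inv_lt_one_of_one_lt₀ hp1))
  have hp0 : p ^ 2 ≠ 0 := by positivity
  obtain ⟨r, hr0, hr⟩ : ∃ r : ℝ, 0 < r ∧ r ^ (p ^ 2) = ‖π‖ :=
    ⟨‖π‖ ^ (((p ^ 2 : ℕ) : ℝ)⁻¹), Real.rpow_pos_of_pos hw0 _,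
      Real.rpow_inv_natCast_pow hw0.le hp0⟩
  have hr1 : r < 1 := by
    by_contra h
    have h1 := one_le_pow₀ (n := p ^ 2) (not_lt.1 h)
    linarith
  have hwr : ‖π‖ ≤ r := by
    rw [← hr]
    exact pow_le_of_le_one hr0.le hr1.le hp0
  refine ⟨r, hr0, hr1, fun m => ?_⟩
  have h := congrArg (coeff m) (mk_dworkCoef_eq_prod hp2 hπ (m + p) (by omega))
  rw [coeff_mk] at h
  rw [h]
  refine norm_coeff_mul_le_pow hr0.le (m + p) ?_ ?_ m (by omega)
  · intro j hj
    rcases j with _ | _ | j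
    · rw [coeff_zero_prod_expMon (fun k => -(π ^ k / (k : K)))]
      simp
    · rw [zero_add, coeff_one_prod_expMon π _ (by omega), norm_neg, pow_one]
      exact hwr
    · rw [coeff_prod_expMon_eq_zero π _ _ (by omega) hj, norm_zero]
      positivity
  · refine norm_coeff_prod_le_pow hr0.le (fun k => expMon (π ^ k / (k : K)) k) _ _
      fun k hk i _ => ?_
    rw [Finset.mem_erase, Finset.mem_erase, Finset.mem_Icc] at hk
    exact norm_coeff_expMon_le hpnorm hπ hr0 hr1 hr (by omega) hk.1 i

end DworkEstimate

section ZSeries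

/-- The exponent of `∏ i, (x^{e_i B})^{k_i}`. -/
def rowComb {n : ℕ} (B : Matrix (Fin n) (Fin n) ℕ) (k : Fin n → ℕ) : Fin n → ℕ :=
  fun j => ∑ i, k i * B i j

lemma rowComb_add {n : ℕ} (B : Matrix (Fin n) (Fin n) ℕ) (k l : Fin n → ℕ) :
    rowComb B (k + l) = rowComb B k + rowComb B l := by
  funext j
  simp [rowComb, add_mul, Finset.sum_add_distrib]

lemma rowComb_single {n : ℕ} (B : Matrix (Fin n) (Fin n) ℕ) (i : Fin n) (q : ℕ) :
    rowComb B (Pi.single i q) = fun j => q * B i j := by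
  funext j
  rw [rowComb, Finset.sum_eq_single i]
  · simp
  · intro l _ hl
    simp [hl]
  · simp

lemma gamRow_add {n : ℕ} (B : Matrix (Fin n) (Fin n) ℕ) (γ δ : Fin n → ℕ) :
    gamRow B (γ + δ) = gamRow B γ + gamRow B δ := by
  rw [gamRow, gamRow, gamRow, ← Matrix.add_vecMul]
  congr 1
  funext i
  simp

lemma gamRow_rowComb {n : ℕ} {B : Matrix (Fin n) (Fin n) ℕ} (hB : (Aq B).det ≠ 0)
    (k : Fin n → ℕ) : gamRow B (rowComb B k) = fun i => (k i : ℚ) := by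
  have h : (fun i => (rowComb B k i : ℚ)) = Matrix.vecMul (fun i => (k i : ℚ)) (Aq B) := by
    funext j
    simp [rowComb, Matrix.vecMul, dotProduct, Aq]
  rw [gamRow, h, Matrix.vecMul_vecMul, Matrix.mul_nonsing_inv _ (isUnit_iff_ne_zero.2 hB),
    Matrix.vecMul_one]

lemma rowComb_injective {n : ℕ} {B : Matrix (Fin n) (Fin n) ℕ} (hB : (Aq B).det ≠ 0) :
    Function.Injective (rowComb B) := by
  intro k l h
  have h1 := gamRow_rowComb hB k
  rw [h, gamRow_rowComb hB l] at h1
  funext i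
  exact_mod_cast (congrFun h1 i).symm

/-- A vector is recovered from its coordinates with respect to the rows of `B`. -/
lemma sum_gamRow_mul {n : ℕ} {B : Matrix (Fin n) (Fin n) ℕ} (hB : (Aq B).det ≠ 0)
    (γ : Fin n → ℕ) (i : Fin n) : ∑ j, gamRow B γ j * (B j i : ℚ) = γ i := by
  have h : Matrix.vecMul (gamRow B γ) (Aq B) = fun i => (γ i : ℚ) := by
    rw [gamRow, Matrix.vecMul_vecMul, Matrix.nonsing_inv_mul _ (isUnit_iff_ne_zero.2 hB),
      Matrix.vecMul_one]
  exact congrFun h i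

lemma le_sum_rowComb {n : ℕ} {B : Matrix (Fin n) (Fin n) ℕ} (hB : (Aq B).det ≠ 0)
    (k : Fin n → ℕ) (i : Fin n) : k i ≤ ∑ j, rowComb B k j := by
  obtain ⟨j, hj⟩ : ∃ j, B i j ≠ 0 := by
    by_contra! h
    exact hB (Matrix.det_eq_zero_of_row_eq_zero i fun j => by simp [Aq, h j])
  calc k i ≤ k i * B i j := Nat.le_mul_of_pos_right _ (Nat.pos_of_ne_zero hj)
    _ ≤ rowComb B k j :=
      Finset.single_le_sum (f := fun l => k l * B l j) (fun _ _ => Nat.zero_le _)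
        (Finset.mem_univ i)
    _ ≤ ∑ j, rowComb B k j :=
      Finset.single_le_sum (fun _ _ => Nat.zero_le _) (Finset.mem_univ j)

lemma Zcoef_rowComb {F : Type} [Field F] {n : ℕ} (p : ℕ) (π : F)
    {B : Matrix (Fin n) (Fin n) ℕ} (hB : (Aq B).det ≠ 0) (k : Fin n → ℕ) :
    Zcoef F p π B (rowComb B k) = ∏ i, dworkCoef F p π (k i) := by
  rw [Zcoef, Finset.sum_eq_single k]
  · exact if_pos fun j => rfl
  · intro l _ hl
    rw [if_neg]
    intro h
    exact hl (rowComb_injective hB (funext h))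
  · intro h
    refine absurd (Fintype.mem_piFinset.2 fun i => Finset.mem_range.2 ?_) h
    exact Nat.lt_succ_of_le (le_sum_rowComb hB k i)

lemma Zcoef_eq_zero {F : Type} [Field F] {n : ℕ} (p : ℕ) (π : F)
    {B : Matrix (Fin n) (Fin n) ℕ} {δ : Fin n → ℕ} (h : ∀ k, rowComb B k ≠ δ) :
    Zcoef F p π B δ = 0 := by
  refine Finset.sum_eq_zero fun k _ => if_neg fun hk => h k (funext hk)

lemma gamRow_nonneg_of_Zcoef_ne_zero {F : Type} [Field F] {n : ℕ} {p : ℕ} {π : F}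
    {B : Matrix (Fin n) (Fin n) ℕ} (hB : (Aq B).det ≠ 0) {δ : Fin n → ℕ}
    (h : Zcoef F p π B δ ≠ 0) (i : Fin n) : 0 ≤ gamRow B δ i := by
  obtain ⟨k, rfl⟩ : ∃ k, rowComb B k = δ := by
    by_contra! hk
    exact h (Zcoef_eq_zero p π hk)
  rw [gamRow_rowComb hB]
  positivity

/-- The coefficient of `x^δ` in `x^e Z_B(x)`. -/
def Zshift (F : Type) [Field F] {n : ℕ} (p : ℕ) (π : F) (B : Matrix (Fin n) (Fin n) ℕ)
    (e δ : Fin n → ℕ) : F :=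
  if ∀ k, e k ≤ δ k then Zcoef F p π B (fun k => δ k - e k) else 0

lemma Zshift_rowComb {F : Type} [Field F] {n : ℕ} (p : ℕ) (π : F)
    {B : Matrix (Fin n) (Fin n) ℕ} (hB : (Aq B).det ≠ 0) (k : Fin n → ℕ) (i : Fin n) (q : ℕ) :
    Zshift F p π B (fun j => q * B i j) (rowComb B k)
      = (if q ≤ k i then dworkCoef F p π (k i - q) else 0)
        * ∏ l ∈ Finset.univ.erase i, dworkCoef F p π (k l) := by
  by_cases hq : q ≤ k i
  · have hk : k = Function.update k i (k i - q) + Pi.single i q := by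
      funext l
      by_cases hl : l = i
      · subst hl
        simp [hq]
      · simp [hl]
    have hr : ∀ j, rowComb B k j
        = rowComb B (Function.update k i (k i - q)) j + q * B i j := by
      intro j
      conv_lhs => rw [hk, rowComb_add, rowComb_single]
      rfl
    have hs : (fun j => rowComb B k j - q * B i j)
        = rowComb B (Function.update k i (k i - q)) := by
      funext j
      rw [hr j, Nat.add_sub_cancel]
    rw [Zshift, if_pos fun j => by rw [hr j]; exact Nat.le_add_left _ _, hs,
      Zcoef_rowComb p π hB, if_pos hq, ← Finset.mul_prod_erase _ _ (Finset.mem_univ i)]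
    congr 1
    · simp
    · refine Finset.prod_congr rfl fun l hl => ?_
      rw [Function.update_of_ne (Finset.ne_of_mem_erase hl)]
  · rw [if_neg hq, zero_mul, Zshift]
    split_ifs with h
    · refine Zcoef_eq_zero p π fun l hl => hq ?_
      have hkl : rowComb B (l + Pi.single i q) = rowComb B k := by
        rw [rowComb_add, hl, rowComb_single]
        funext j
        exact Nat.sub_add_cancel (h j)
      rw [← rowComb_injective hB hkl]
      simp
    · rfl

lemma Zshift_eq_zero {F : Type} [Field F] {n : ℕ} (p : ℕ) (π : F)
    {B : Matrix (Fin n) (Fin n) ℕ} {δ : Fin n → ℕ} (h : ∀ k, rowComb B k ≠ δ) (i : Fin n)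
    (q : ℕ) : Zshift F p π B (fun j => q * B i j) δ = 0 := by
  rw [Zshift]
  split_ifs with hle
  · refine Zcoef_eq_zero p π fun l hl => h (l + Pi.single i q) ?_
    rw [rowComb_add, hl, rowComb_single]
    funext j
    exact Nat.sub_add_cancel (hle j)
  · rfl

/-- The differential equation of `Z_B` with respect to the `i`-th row monomial. -/
lemma gamRow_mul_Zcoef {F : Type} [Field F] [CharZero F] {n : ℕ} {p : ℕ} (hp : 0 < p) (π : F)
    {B : Matrix (Fin n) (Fin n) ℕ} (hB : (Aq B).det ≠ 0) (δ : Fin n → ℕ) (i : Fin n) :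
    ((gamRow B δ i : ℚ) : F) * Zcoef F p π B δ
      = π * (p * Zshift F p π B (fun j => p * B i j) δ
        - Zshift F p π B (fun j => B i j) δ) := by
  have h1 : (fun j => B i j) = fun j => 1 * B i j := by simp
  rw [h1]
  by_cases hδ : ∃ k, rowComb B k = δ
  · obtain ⟨k, rfl⟩ := hδ
    rw [gamRow_rowComb hB, Zcoef_rowComb p π hB, Zshift_rowComb p π hB, Zshift_rowComb p π hB,
      ← Finset.mul_prod_erase _ _ (Finset.mem_univ i), ← mul_assoc, Rat.cast_natCast,
      dworkCoef_recurrence hp]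
    ring
  · push Not at hδ
    rw [Zcoef_eq_zero p π hδ, Zshift_eq_zero p π hδ, Zshift_eq_zero p π hδ]
    ring

/-- The differential equation of `Z_B` with respect to the variable `x_i`. -/
lemma natCast_mul_Zcoef {F : Type} [Field F] [CharZero F] {n : ℕ} {p : ℕ} (hp : 0 < p) (π : F)
    {B : Matrix (Fin n) (Fin n) ℕ} (hB : (Aq B).det ≠ 0) (δ : Fin n → ℕ) (i : Fin n) :
    (δ i : F) * Zcoef F p π B δ
      = ∑ j, (B j i : F) * (π * (p * Zshift F p π B (fun l => p * B j l) δ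
        - Zshift F p π B (fun l => B j l) δ)) := by
  have h : (δ i : F) = ∑ j, ((gamRow B δ j : ℚ) : F) * (B j i : F) := by
    have h1 := congrArg (Rat.cast : ℚ → F) (sum_gamRow_mul hB δ i)
    push_cast at h1
    exact h1.symm
  rw [h, Finset.sum_mul]
  refine Finset.sum_congr rfl fun j _ => ?_
  rw [← gamRow_mul_Zcoef hp π hB]
  ring

lemma exists_norm_Zcoef_le_pow {K : Type} [NontriviallyNormedField K] [CharZero K]
    [IsUltrametricDist K] {p : ℕ} [hp : Fact p.Prime] (hpnorm : ‖(p : K)‖ = (p : ℝ)⁻¹)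
    {π : K} (hπ : π ^ (p - 1) = -(p : K)) {n : ℕ} {B : Matrix (Fin n) (Fin n) ℕ}
    (hB : (Aq B).det ≠ 0) :
    ∃ r : ℝ, 0 < r ∧ r < 1 ∧ ∀ δ, ‖Zcoef K p π B δ‖ ≤ r ^ (∑ i, δ i) := by
  obtain ⟨r, hr0, hr1, hr⟩ := exists_norm_dworkCoef_le_pow hpnorm hπ
  set c : ℕ := 1 + ∑ i, ∑ j, B i j with hc
  have hc0 : c ≠ 0 := by omega
  obtain ⟨s, hs0, hs⟩ : ∃ s : ℝ, 0 < s ∧ s ^ c = r :=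
    ⟨r ^ ((c : ℝ)⁻¹), Real.rpow_pos_of_pos hr0 _, Real.rpow_inv_natCast_pow hr0.le hc0⟩
  have hs1 : s < 1 := by
    by_contra h
    have h1 := one_le_pow₀ (n := c) (not_lt.1 h)
    linarith
  refine ⟨s, hs0, hs1, fun δ => ?_⟩
  by_cases hδ : ∃ k, rowComb B k = δ
  · obtain ⟨k, rfl⟩ := hδ
    rw [Zcoef_rowComb p π hB, norm_prod]
    calc ∏ i, ‖dworkCoef K p π (k i)‖ ≤ ∏ i, r ^ (k i) :=
          Finset.prod_le_prod (fun i _ => norm_nonneg _) fun i _ => hr _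
      _ = s ^ (c * ∑ i, k i) := by rw [Finset.prod_pow_eq_pow_sum, pow_mul, hs]
      _ ≤ s ^ (∑ j, rowComb B k j) := by
          refine pow_le_pow_of_le_one hs0.le hs1.le ?_
          simp only [rowComb]
          rw [Finset.sum_comm, Finset.mul_sum]
          refine Finset.sum_le_sum fun i _ => ?_
          rw [← Finset.mul_sum, mul_comm]
          refine Nat.mul_le_mul_right _ ?_
          have := Finset.single_le_sum (f := fun i => ∑ j, B i j) (fun _ _ => Nat.zero_le _)
            (Finset.mem_univ i)
          omega
  · push Not at hδ
    rw [Zcoef_eq_zero p π hδ, norm_zero]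
    positivity

end ZSeries

section Overconvergence

lemma exists_geometric_bound {K : Type} [NontriviallyNormedField K] {p : ℕ} [hp : Fact p.Prime]
    {α : Type} {d : α → ℕ} {f : α → K}
    (h : ∃ M : ℝ, 0 < M ∧ {a | ¬ ‖f a‖ ≤ (p : ℝ) ^ (-(M * (d a : ℝ)))}.Finite) :
    ∃ C t : ℝ, 0 ≤ C ∧ 0 < t ∧ t < 1 ∧ ∀ a, ‖f a‖ ≤ C * t ^ d a := by
  obtain ⟨M, hM, hfin⟩ := h
  have hp1 : (1 : ℝ) < p := by exact_mod_cast hp.out.one_lt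
  have hp0 : (0 : ℝ) < p := by linarith
  set t : ℝ := (p : ℝ) ^ (-M) with ht
  have ht0 : 0 < t := Real.rpow_pos_of_pos hp0 _
  have htd : ∀ k : ℕ, (p : ℝ) ^ (-(M * (k : ℝ))) = t ^ k := fun k => by
    rw [ht, ← Real.rpow_natCast, ← Real.rpow_mul hp0.le, neg_mul]
  have hS : ∀ a, 0 ≤ ‖f a‖ / t ^ d a := fun a => by positivity
  refine ⟨1 + ∑ a ∈ hfin.toFinset, ‖f a‖ / t ^ d a, t,
    add_nonneg zero_le_one (Finset.sum_nonneg fun a _ => hS a), ht0,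
    Real.rpow_lt_one_of_one_lt_of_neg hp1 (by linarith), fun a => ?_⟩
  by_cases ha : ‖f a‖ ≤ (p : ℝ) ^ (-(M * (d a : ℝ)))
  · rw [htd] at ha
    refine ha.trans (le_mul_of_one_le_left (by positivity) ?_)
    linarith [Finset.sum_nonneg fun a (_ : a ∈ hfin.toFinset) => hS a]
  · rw [← div_le_iff₀ (by positivity)]
    have h1 : ‖f a‖ / t ^ d a ≤ ∑ a ∈ hfin.toFinset, ‖f a‖ / t ^ d a :=
      Finset.single_le_sum (f := fun a => ‖f a‖ / t ^ d a) (fun a _ => hS a)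
        (hfin.mem_toFinset.2 ha)
    linarith

lemma overconvergent_of_geometric_bound {K : Type} [NontriviallyNormedField K] {p : ℕ}
    [hp : Fact p.Prime] {α : Type} {d : α → ℕ} (hd : ∀ N, {a | d a ≤ N}.Finite) {f : α → K}
    {C t : ℝ} (ht0 : 0 < t) (ht1 : t < 1) (h : ∀ a, ‖f a‖ ≤ C * t ^ d a) :
    ∃ M : ℝ, 0 < M ∧ {a | ¬ ‖f a‖ ≤ (p : ℝ) ^ (-(M * (d a : ℝ)))}.Finite := by
  have hp1 : (1 : ℝ) < p := by exact_mod_cast hp.out.one_lt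
  have hp0 : (0 : ℝ) < p := by linarith
  set u : ℝ := Real.sqrt t with hu
  have hu0 : 0 < u := Real.sqrt_pos.2 ht0
  have hu1 : u < 1 := by
    rw [hu, Real.sqrt_lt' one_pos]
    simpa using ht1
  have hut : t = u * u := (Real.mul_self_sqrt ht0.le).symm
  refine ⟨-Real.logb p u, by linarith [Real.logb_neg hp1 hu0 hu1], ?_⟩
  have hpu : ∀ k : ℕ, (p : ℝ) ^ (-(-Real.logb p u * (k : ℝ))) = u ^ k := fun k => by
    rw [neg_mul, neg_neg, Real.rpow_mul hp0.le, Real.rpow_logb hp0 hp1.ne' hu0,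
      Real.rpow_natCast]
  obtain ⟨N, hN⟩ : ∃ N, ∀ k, N ≤ k → C * u ^ k ≤ 1 := by
    have h1 := (tendsto_pow_atTop_nhds_zero_of_lt_one hu0.le hu1).const_mul C
    rw [mul_zero] at h1
    exact Filter.eventually_atTop.1 (h1.eventually_le_const one_pos)
  refine (hd N).subset fun a ha => ?_
  by_contra hlt
  simp only [Set.mem_ofPred_eq, not_le] at hlt
  refine ha ?_
  rw [hpu]
  calc ‖f a‖ ≤ C * t ^ d a := h a
    _ = C * u ^ d a * u ^ d a := by rw [hut, mul_pow, mul_assoc]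
    _ ≤ u ^ d a := mul_le_of_le_one_left (by positivity) (hN _ hlt.le)

lemma finite_degMon_le {n : ℕ} (N : ℕ) : {m : MonIdx (Fin n) | degMon m ≤ N}.Finite := by
  refine (Set.finite_Icc (0 : MonIdx (Fin n)) (fun _ => N, fun _ => N)).subset fun m hm => ?_
  have h : (∑ i, m.1 i) + ∑ i, m.2 i ≤ N := hm
  refine ⟨⟨fun i => Nat.zero_le _, fun i => Nat.zero_le _⟩, fun i => ?_, fun i => ?_⟩
  · have := Finset.single_le_sum (f := m.1) (fun _ _ => Nat.zero_le _) (Finset.mem_univ i)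
    show m.1 i ≤ N
    omega
  · have := Finset.single_le_sum (f := m.2) (fun _ _ => Nat.zero_le _) (Finset.mem_univ i)
    show m.2 i ≤ N
    omega

lemma finite_degMon_AMon_le {n : ℕ} (A : Matrix (Fin n) (Fin n) ℕ) (N : ℕ) :
    {m : AMon A | degMon m.1 ≤ N}.Finite :=
  (finite_degMon_le N).preimage Subtype.val_injective.injOn

lemma finite_degMon_BIdx_le {n : ℕ} (A : Matrix (Fin n) (Fin n) ℕ) (N : ℕ) :
    {q : BIdx A | degMon q.1.1 ≤ N}.Finite :=
  ((finite_degMon_AMon_le A N).prod Set.finite_univ).subset fun _ hq => ⟨hq, Set.mem_univ _⟩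

lemma norm_ZmulF_le {K : Type} [NontriviallyNormedField K] [IsUltrametricDist K] {n p : ℕ}
    {π : K} {A : Matrix (Fin n) (Fin n) ℕ} {C t : ℝ} (hC : 0 ≤ C) (ht : 0 < t)
    (hA : ∀ δ, ‖Zcoef K p π A δ‖ ≤ t ^ (∑ i, δ i))
    (hAT : ∀ δ, ‖Zcoef K p π Aᵀ δ‖ ≤ t ^ (∑ i, δ i)) {c : RFull K (p • A)}
    (hc : ∀ m, ‖c m‖ ≤ C * t ^ degMon m.1) (m' : AMon A) :
    ‖ZmulF K p π A c m'‖ ≤ C * t ^ degMon m'.1 := by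
  have h0 : 0 ≤ C * t ^ degMon m'.1 := by positivity
  refine IsUltrametricDist.norm_sum_le_of_forall_le_of_nonneg h0 fun δ _ =>
    IsUltrametricDist.norm_sum_le_of_forall_le_of_nonneg h0 fun ε _ => ?_
  split_ifs with h
  · have hsum : ∀ a b : Fin n → ℕ, (∀ k, a k ≤ b k) →
        (∑ k, (b k - a k)) + ∑ k, a k = ∑ k, b k := fun a b hab => by
      rw [← Finset.sum_add_distrib]
      exact Finset.sum_congr rfl fun k _ => Nat.sub_add_cancel (hab k)
    have h1 := hsum _ _ h.1
    have h2 := hsum _ _ h.2.1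
    rw [norm_mul, norm_mul]
    calc ‖Zcoef K p π A δ‖ * ‖Zcoef K p π Aᵀ ε‖ * ‖c _‖
        ≤ t ^ (∑ i, δ i) * t ^ (∑ i, ε i) * (C * t ^ degMon _) := by
          refine mul_le_mul (mul_le_mul (hA δ) (hAT ε) (norm_nonneg _) (by positivity)) (hc _)
            (norm_nonneg _) (by positivity)
      _ = C * t ^ degMon m'.1 := by
          have hdeg : degMon m'.1 = (∑ i, δ i) + (∑ i, ε i)
              + degMon ((fun k => m'.1.1 k - δ k), (fun k => m'.1.2 k - ε k)) := by
            simp only [degMon]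
            omega
          rw [hdeg, pow_add, pow_add]
          ring
  · rw [mul_zero, norm_zero]
    exact h0

lemma tmap_id_apply {F : Type} [Field F] {n : ℕ} {α β : Type} (T : (α → F) →ₗ[F] (β → F))
    (c : α × Finset (Fin n) → F) (b : β) (S : Finset (Fin n)) :
    tmap T LinearMap.id c (b, S) = T (fun a => c (a, S)) b := by
  show ∑ S' : Finset (Fin n), (Pi.single S' (1 : F) : Finset (Fin n) → F) S
    * T (fun a => c (a, S')) b = _
  rw [Finset.sum_eq_single S]
  · rw [Pi.single_eq_same, one_mul]
  · intro S' _ hS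
    rw [Pi.single_eq_of_ne (Ne.symm hS), zero_mul]
  · intro h
    exact absurd (Finset.mem_univ S) h

lemma overcR_ZmulF {K : Type} [NontriviallyNormedField K] [IsUltrametricDist K] {n p : ℕ}
    [hp : Fact p.Prime] {π : K} {A : Matrix (Fin n) (Fin n) ℕ} {t : ℝ} (ht0 : 0 < t)
    (ht1 : t < 1) (hA : ∀ δ, ‖Zcoef K p π A δ‖ ≤ t ^ (∑ i, δ i))
    (hAT : ∀ δ, ‖Zcoef K p π Aᵀ δ‖ ≤ t ^ (∑ i, δ i)) {c : RFull K (p • A)}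
    (hc : OvercR p c) : OvercR p (ZmulF K p π A c) := by
  obtain ⟨C, s, hC, hs0, hs1, hcs⟩ :=
    exists_geometric_bound (f := c) (d := fun m : AMon (p • A) => degMon m.1) hc
  refine overconvergent_of_geometric_bound (d := fun m : AMon A => degMon m.1) (C := C)
    (finite_degMon_AMon_le A) (lt_max_of_lt_left hs0) (max_lt hs1 ht1) fun m => ?_
  exact norm_ZmulF_le hC (lt_max_of_lt_left hs0)
    (fun δ => (hA δ).trans (pow_le_pow_left₀ ht0.le (le_max_right s t) _))
    (fun δ => (hAT δ).trans (pow_le_pow_left₀ ht0.le (le_max_right s t) _))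
    (fun m => (hcs m).trans
      (mul_le_mul_of_nonneg_left (pow_le_pow_left₀ hs0.le (le_max_left s t) _) hC)) m

lemma overcB_FrDoublePrime {K : Type} [NontriviallyNormedField K] [IsUltrametricDist K]
    {n p : ℕ} [hp : Fact p.Prime] {π : K} {A : Matrix (Fin n) (Fin n) ℕ} {t : ℝ}
    (ht0 : 0 < t) (ht1 : t < 1) (hA : ∀ δ, ‖Zcoef K p π A δ‖ ≤ t ^ (∑ i, δ i))
    (hAT : ∀ δ, ‖Zcoef K p π Aᵀ δ‖ ≤ t ^ (∑ i, δ i)) {c : BFull K (p • A)}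
    (hc : OvercB p c) : OvercB p (FrDoublePrime K p π A c) := by
  obtain ⟨C, s, hC, hs0, hs1, hcs⟩ :=
    exists_geometric_bound (f := c) (d := fun q : BIdx (p • A) => degMon q.1.1) hc
  refine overconvergent_of_geometric_bound (d := fun q : BIdx A => degMon q.1.1) (C := C)
    (finite_degMon_BIdx_le A) (lt_max_of_lt_left hs0) (max_lt hs1 ht1) fun q => ?_
  obtain ⟨m, S⟩ := q
  rw [FrDoublePrime, LinearMap.comp_apply, tmap_id_apply]
  refine norm_ZmulF_le hC (lt_max_of_lt_left hs0)
    (fun δ => (hA δ).trans (pow_le_pow_left₀ ht0.le (le_max_right s t) _))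
    (fun δ => (hAT δ).trans (pow_le_pow_left₀ ht0.le (le_max_right s t) _))
    (fun m => ?_) m
  have h1 : ‖(p : K) ^ qexpDual (p • A) (m, S)‖ ≤ 1 := by
    rw [norm_pow]
    exact pow_le_one₀ (norm_nonneg _) (IsUltrametricDist.norm_natCast_le_one K p)
  calc ‖(p : K) ^ qexpDual (p • A) (m, S) * c (m, S)‖ ≤ ‖c (m, S)‖ := by
        rw [norm_mul]
        exact mul_le_of_le_one_left (norm_nonneg _) h1
    _ ≤ C * max s t ^ degMon m.1 := (hcs (m, S)).trans
      (mul_le_mul_of_nonneg_left (pow_le_pow_left₀ hs0.le (le_max_left s t) _) hC)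

end Overconvergence

section SeriesRing

open MvPowerSeries

lemma Aq_transpose_det {n : ℕ} (A : Matrix (Fin n) (Fin n) ℕ) : (Aq Aᵀ).det = (Aq A).det :=
  Matrix.det_transpose (Aq A)

lemma Aq_smul {n : ℕ} (p : ℕ) (A : Matrix (Fin n) (Fin n) ℕ) : Aq (p • A) = (p : ℚ) • Aq A := by
  ext i j
  simp only [Aq, Matrix.map_apply, Matrix.smul_apply, smul_eq_mul, Nat.cast_mul]

lemma Aq_smul_det_ne_zero {n p : ℕ} (hp : p ≠ 0) {A : Matrix (Fin n) (Fin n) ℕ}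
    (hA : (Aq A).det ≠ 0) : (Aq (p • A)).det ≠ 0 := by
  rw [Aq_smul, Matrix.det_smul]
  exact mul_ne_zero (pow_ne_zero _ (Nat.cast_ne_zero.2 hp)) hA

lemma mul_gamRow_smul {n p : ℕ} (hp : p ≠ 0) {A : Matrix (Fin n) (Fin n) ℕ}
    (hA : (Aq A).det ≠ 0) (γ : Fin n → ℕ) (i : Fin n) :
    (p : ℚ) * gamRow (p • A) γ i = gamRow A γ i := by
  have h : Matrix.vecMul ((p : ℚ) • gamRow (p • A) γ) (Aq A) = fun i => (γ i : ℚ) := by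
    rw [Matrix.smul_vecMul, ← Matrix.vecMul_smul, ← Aq_smul, gamRow, Matrix.vecMul_vecMul,
      Matrix.nonsing_inv_mul _ (isUnit_iff_ne_zero.2 (Aq_smul_det_ne_zero hp hA)),
      Matrix.vecMul_one]
  have h2 : gamRow A γ = (p : ℚ) • gamRow (p • A) γ := by
    rw [gamRow, ← h, Matrix.vecMul_vecMul, Matrix.mul_nonsing_inv _ (isUnit_iff_ne_zero.2 hA),
      Matrix.vecMul_one]
  rw [h2]
  rfl

lemma mul_lamRow_smul {n p : ℕ} (hp : p ≠ 0) {A : Matrix (Fin n) (Fin n) ℕ}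
    (hA : (Aq A).det ≠ 0) (l : Fin n → ℕ) (i : Fin n) :
    (p : ℚ) * lamRow (p • A) l i = lamRow A l i :=
  mul_gamRow_smul (A := Aᵀ) hp (by rwa [Aq_transpose_det]) l i

lemma lamRow_add {n : ℕ} (A : Matrix (Fin n) (Fin n) ℕ) (l l' : Fin n → ℕ) (i : Fin n) :
    lamRow A (l + l') i = lamRow A l i + lamRow A l' i :=
  congrFun (gamRow_add Aᵀ l l') i

lemma lamRow_zero {n : ℕ} (A : Matrix (Fin n) (Fin n) ℕ) (i : Fin n) : lamRow A 0 i = 0 := by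
  have h := lamRow_add A 0 0 i
  rw [add_zero] at h
  linarith

lemma lamRow_column {n : ℕ} {A : Matrix (Fin n) (Fin n) ℕ} (hA : (Aq A).det ≠ 0)
    (i k : Fin n) : lamRow A (fun j => A j i) k = if k = i then 1 else 0 := by
  have h := gamRow_rowComb (B := Aᵀ) (by rwa [Aq_transpose_det]) (Pi.single i 1)
  rw [rowComb_single] at h
  simp only [one_mul] at h
  have h2 := congrFun h k
  rw [Pi.single_apply] at h2
  exact h2.trans (by split_ifs <;> simp)

/-- Allowed monomials have complementary supports. -/
lemma OKA_iff {n : ℕ} (A : Matrix (Fin n) (Fin n) ℕ) (m : MonIdx (Fin n)) :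
    OKA A m ↔ (∀ i, 0 ≤ lamRow A m.2 i) ∧ ∀ i, m.1 i = 0 ∨ lamRow A m.2 i = 0 := by
  have hpair : (gamRow A m.1 ⬝ᵥ fun i => ((m.2 i : ℚ))) = ∑ i, (m.1 i : ℚ) * lamRow A m.2 i := by
    rw [gamRow, ← Matrix.dotProduct_mulVec, lamRow, ← Matrix.transpose_nonsing_inv,
      Matrix.vecMul_transpose]
    rfl
  rw [OKA, hpair]
  refine and_congr_right fun h => ?_
  rw [Finset.sum_eq_zero_iff_of_nonneg fun i _ => mul_nonneg (Nat.cast_nonneg _) (h i)]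
  simp

lemma OKA_smul_iff {n p : ℕ} (hp : p ≠ 0) {A : Matrix (Fin n) (Fin n) ℕ}
    (hA : (Aq A).det ≠ 0) (m : MonIdx (Fin n)) : OKA (p • A) m ↔ OKA A m := by
  have hp0 : (0 : ℚ) < p := by exact_mod_cast Nat.pos_of_ne_zero hp
  rw [OKA_iff, OKA_iff]
  simp only [← mul_lamRow_smul hp hA, mul_nonneg_iff_of_pos_left hp0, mul_eq_zero, hp0.ne',
    false_or]

/-- The exponent of the monomial `x^γ y^λ` in the power series ring in the variables `x, y`. -/
noncomputable def toExp {n : ℕ} (m : MonIdx (Fin n)) : (Fin n ⊕ Fin n) →₀ ℕ :=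
  Finsupp.equivFunOnFinite.symm (Sum.elim m.1 m.2)

/-- The index `(γ, λ)` of an exponent in the variables `x, y`. -/
def ofExp {n : ℕ} (a : (Fin n ⊕ Fin n) →₀ ℕ) : MonIdx (Fin n) :=
  (fun i => a (Sum.inl i), fun i => a (Sum.inr i))

lemma ofExp_toExp {n : ℕ} (m : MonIdx (Fin n)) : ofExp (toExp m) = m := rfl

lemma toExp_ofExp {n : ℕ} (a : (Fin n ⊕ Fin n) →₀ ℕ) : toExp (ofExp a) = a := by
  ext i
  cases i <;> rfl

lemma ofExp_add {n : ℕ} (a b : (Fin n ⊕ Fin n) →₀ ℕ) : ofExp (a + b) = ofExp a + ofExp b := rfl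

lemma toExp_le_iff {n : ℕ} (e : MonIdx (Fin n)) (a : (Fin n ⊕ Fin n) →₀ ℕ) :
    toExp e ≤ a ↔ (∀ k, e.1 k ≤ (ofExp a).1 k) ∧ ∀ k, e.2 k ≤ (ofExp a).2 k := by
  constructor
  · intro h
    exact ⟨fun k => h (Sum.inl k), fun k => h (Sum.inr k)⟩
  · rintro ⟨h1, h2⟩ (k | k)
    · exact h1 k
    · exact h2 k

lemma ofExp_sub_toExp {n : ℕ} (a : (Fin n ⊕ Fin n) →₀ ℕ) (e : MonIdx (Fin n)) :
    ofExp (a - toExp e)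
      = ((fun k => (ofExp a).1 k - e.1 k), fun k => (ofExp a).2 k - e.2 k) := rfl

/-- Extension by zero of a series supported on the allowed monomials. -/
noncomputable def extS {F : Type} [Field F] {n : ℕ} (A : Matrix (Fin n) (Fin n) ℕ)
    (c : RFull F A) : MvPowerSeries (Fin n ⊕ Fin n) F :=
  fun a => if h : OKA A (ofExp a) then c ⟨ofExp a, h⟩ else 0

/-- Truncation of a power series to the allowed monomials. -/
noncomputable def resS {F : Type} [Field F] {n : ℕ} (A : Matrix (Fin n) (Fin n) ℕ)
    (f : MvPowerSeries (Fin n ⊕ Fin n) F) : RFull F A :=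
  fun m => coeff (toExp m.1) f

/-- The diagonal operator with weight `w` on power series in `x, y`. -/
noncomputable def diagS {F : Type} [Field F] {n : ℕ} (w : MonIdx (Fin n) → F)
    (f : MvPowerSeries (Fin n ⊕ Fin n) F) : MvPowerSeries (Fin n ⊕ Fin n) F :=
  fun a => w (ofExp a) * coeff a f

/-- The series is supported on the cone `λ A⁻ᵀ ≥ 0`. -/
def InCone {F : Type} [Field F] {n : ℕ} (A : Matrix (Fin n) (Fin n) ℕ)
    (f : MvPowerSeries (Fin n ⊕ Fin n) F) : Prop :=
  ∀ a, coeff a f ≠ 0 → ∀ i, 0 ≤ lamRow A (ofExp a).2 i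

lemma coeff_extS {F : Type} [Field F] {n : ℕ} (A : Matrix (Fin n) (Fin n) ℕ) (c : RFull F A)
    (a : (Fin n ⊕ Fin n) →₀ ℕ) :
    coeff a (extS A c) = if h : OKA A (ofExp a) then c ⟨ofExp a, h⟩ else 0 := rfl

lemma coeff_diagS {F : Type} [Field F] {n : ℕ} (w : MonIdx (Fin n) → F)
    (f : MvPowerSeries (Fin n ⊕ Fin n) F) (a : (Fin n ⊕ Fin n) →₀ ℕ) :
    coeff a (diagS w f) = w (ofExp a) * coeff a f := rfl

lemma coeff_extS_resS {F : Type} [Field F] {n : ℕ} (A : Matrix (Fin n) (Fin n) ℕ)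
    (f : MvPowerSeries (Fin n ⊕ Fin n) F) (a : (Fin n ⊕ Fin n) →₀ ℕ) :
    coeff a (extS A (resS A f)) = if OKA A (ofExp a) then coeff a f else 0 := by
  rw [coeff_extS]
  split_ifs
  · rw [resS, toExp_ofExp]
  · rfl

lemma resS_add {F : Type} [Field F] {n : ℕ} (A : Matrix (Fin n) (Fin n) ℕ)
    (f g : MvPowerSeries (Fin n ⊕ Fin n) F) : resS A (f + g) = resS A f + resS A g := by
  funext m
  simp [resS]

lemma resS_C_mul {F : Type} [Field F] {n : ℕ} (A : Matrix (Fin n) (Fin n) ℕ) (r : F)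
    (f : MvPowerSeries (Fin n ⊕ Fin n) F) : resS A (C r * f) = r • resS A f := by
  funext m
  simp [resS, coeff_C_mul]

lemma resS_diagS_extS_resS {F : Type} [Field F] {n : ℕ} (A : Matrix (Fin n) (Fin n) ℕ)
    (w : MonIdx (Fin n) → F) (f : MvPowerSeries (Fin n ⊕ Fin n) F) :
    resS A (diagS w (extS A (resS A f))) = resS A (diagS w f) := by
  funext m
  rw [resS, resS, coeff_diagS, coeff_diagS, coeff_extS_resS, if_pos]
  exact m.2

/-- A diagonal operator with additive weight is a derivation. -/
lemma diagS_mul {F : Type} [Field F] {n : ℕ} {w : MonIdx (Fin n) → F}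
    (hw : ∀ m m', w (m + m') = w m + w m') (f g : MvPowerSeries (Fin n ⊕ Fin n) F) :
    diagS w (f * g) = diagS w f * g + f * diagS w g := by
  ext a
  rw [coeff_diagS, map_add, coeff_mul, coeff_mul, coeff_mul, Finset.mul_sum,
    ← Finset.sum_add_distrib]
  refine Finset.sum_congr rfl fun q hq => ?_
  have h : q.1 + q.2 = a := Finset.HasAntidiagonal.mem_antidiagonal.1 hq
  rw [coeff_diagS, coeff_diagS, ← h, ofExp_add, hw]
  ring

lemma InCone.extS {F : Type} [Field F] {n : ℕ} {A B : Matrix (Fin n) (Fin n) ℕ}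
    (h : ∀ m, OKA B m ↔ OKA A m) (c : RFull F B) : InCone A (extS B c) := by
  intro a ha
  rw [coeff_extS] at ha
  split_ifs at ha with hOK
  · exact ((h _).1 hOK).1
  · exact absurd rfl ha

lemma InCone.add {F : Type} [Field F] {n : ℕ} {A : Matrix (Fin n) (Fin n) ℕ}
    {f g : MvPowerSeries (Fin n ⊕ Fin n) F} (hf : InCone A f) (hg : InCone A g) :
    InCone A (f + g) := by
  intro a ha
  by_cases h : coeff a f = 0
  · refine hg a fun h' => ha ?_
    rw [map_add, h, h', add_zero]
  · exact hf a h

lemma InCone.sum {F : Type} [Field F] {n : ℕ} {A : Matrix (Fin n) (Fin n) ℕ} {ι : Type}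
    (s : Finset ι) {f : ι → MvPowerSeries (Fin n ⊕ Fin n) F} (hf : ∀ j ∈ s, InCone A (f j)) :
    InCone A (∑ j ∈ s, f j) := by
  intro a ha
  rw [map_sum] at ha
  obtain ⟨j, hj, h⟩ := Finset.exists_ne_zero_of_sum_ne_zero ha
  exact hf j hj a h

lemma InCone.mul {F : Type} [Field F] {n : ℕ} {A : Matrix (Fin n) (Fin n) ℕ}
    {f g : MvPowerSeries (Fin n ⊕ Fin n) F} (hf : InCone A f) (hg : InCone A g) :
    InCone A (f * g) := by
  intro a ha i
  rw [coeff_mul] at ha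
  obtain ⟨q, hq, h⟩ := Finset.exists_ne_zero_of_sum_ne_zero ha
  have hqa : q.1 + q.2 = a := Finset.HasAntidiagonal.mem_antidiagonal.1 hq
  rw [← hqa, ofExp_add, Prod.snd_add, lamRow_add]
  exact add_nonneg (hf _ (left_ne_zero_of_mul h) i) (hg _ (right_ne_zero_of_mul h) i)

lemma InCone.diagS {F : Type} [Field F] {n : ℕ} {A : Matrix (Fin n) (Fin n) ℕ}
    (w : MonIdx (Fin n) → F) {f : MvPowerSeries (Fin n ⊕ Fin n) F} (hf : InCone A f) :
    InCone A (diagS w f) :=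
  fun a ha => hf a (right_ne_zero_of_mul ha)

lemma InCone.monomial {F : Type} [Field F] {n : ℕ} {A : Matrix (Fin n) (Fin n) ℕ}
    {e : MonIdx (Fin n)} (he : ∀ i, 0 ≤ lamRow A e.2 i) (r : F) :
    InCone A (monomial (toExp e) r) := by
  intro a ha
  rw [coeff_monomial] at ha
  split_ifs at ha with h
  · rw [h, ofExp_toExp]
    exact he
  · exact absurd rfl ha

/-- Truncating one factor does not change the truncation of a product of series supported on
the cone. -/
lemma resS_mul_extS_resS {F : Type} [Field F] {n : ℕ} {A B : Matrix (Fin n) (Fin n) ℕ}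
    (hOK : ∀ m, OKA B m ↔ OKA A m) {f g : MvPowerSeries (Fin n ⊕ Fin n) F} (hf : InCone A f)
    (hg : InCone A g) : resS A (f * extS B (resS B g)) = resS A (f * g) := by
  funext m
  rw [resS, resS, coeff_mul, coeff_mul]
  refine Finset.sum_congr rfl fun q hq => ?_
  have hqm : q.1 + q.2 = toExp m.1 := Finset.HasAntidiagonal.mem_antidiagonal.1 hq
  by_cases hfq : coeff q.1 f = 0
  · rw [hfq, zero_mul, zero_mul]
  by_cases hgq : coeff q.2 g = 0
  · rw [coeff_extS_resS, hgq, ite_self]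
  have hmq : m.1 = ofExp q.1 + ofExp q.2 := by rw [← ofExp_add, hqm, ofExp_toExp]
  rw [coeff_extS_resS, if_pos]
  rw [hOK, OKA_iff]
  refine ⟨hg _ hgq, fun i => ?_⟩
  have h1 := hf _ hfq i
  have h2 := hg _ hgq i
  have h3 := ((OKA_iff A m.1).1 m.2).2 i
  rw [hmq, Prod.fst_add, Prod.snd_add, lamRow_add, Pi.add_apply] at h3
  rcases h3 with h3 | h3
  · left; omega
  · right; linarith

lemma coeff_monomial_mul_extS {F : Type} [Field F] {n : ℕ} (B : Matrix (Fin n) (Fin n) ℕ)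
    (e m : MonIdx (Fin n)) (r : F) (c : RFull F B) :
    coeff (toExp m) (monomial (toExp e) r * extS B c)
      = r * if h : ((∀ k, e.1 k ≤ m.1 k) ∧ ∀ k, e.2 k ≤ m.2 k) ∧
          OKA B ((fun k => m.1 k - e.1 k), fun k => m.2 k - e.2 k)
        then c ⟨((fun k => m.1 k - e.1 k), fun k => m.2 k - e.2 k), h.2⟩ else 0 := by
  rw [coeff_monomial_mul]
  by_cases h1 : (∀ k, e.1 k ≤ m.1 k) ∧ ∀ k, e.2 k ≤ m.2 k
  · rw [if_pos ((toExp_le_iff _ _).2 h1)]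
    congr 1
    by_cases h2 : OKA B ((fun k => m.1 k - e.1 k), fun k => m.2 k - e.2 k)
    · rw [dif_pos ⟨h1, h2⟩]
      exact dif_pos h2
    · rw [dif_neg fun h => h2 h.2]
      exact dif_neg h2
  · rw [if_neg fun h => h1 ((toExp_le_iff _ _).1 h), dif_neg fun h => h1 h.1, mul_zero]

/-- The series `x_i ∂(π W_B)/∂x_i`. -/
noncomputable def phiS {F : Type} [Field F] {n : ℕ} (π : F) (B : Matrix (Fin n) (Fin n) ℕ)
    (i : Fin n) : MvPowerSeries (Fin n ⊕ Fin n) F :=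
  ∑ j, monomial (toExp (B j, 0)) (π * (B j i : F))

/-- The monomial `y^{e_i Bᵀ}`. -/
noncomputable def psiS (F : Type) [Field F] {n : ℕ} (B : Matrix (Fin n) (Fin n) ℕ)
    (i : Fin n) : MvPowerSeries (Fin n ⊕ Fin n) F :=
  monomial (toExp (0, fun j => B j i)) 1

lemma dxF_eq_resS {F : Type} [Field F] {n : ℕ} (π : F) (B : Matrix (Fin n) (Fin n) ℕ)
    (i : Fin n) (c : RFull F B) :
    dxF F π B i c
      = resS B (diagS (fun m => (m.1 i : F)) (extS B c) + phiS π B i * extS B c) := by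
  funext m
  rw [resS, map_add, coeff_diagS, coeff_extS, dif_pos (show OKA B (ofExp (toExp m.1)) from m.2),
    phiS, Finset.sum_mul, map_sum]
  have hphi : phiF F π B i c m = ∑ j, coeff (toExp m.1)
      (monomial (toExp (B j, 0)) (π * (B j i : F)) * extS B c) := by
    rw [phiF, LinearMap.smul_apply, LinearMap.sum_apply, Pi.smul_apply, Finset.sum_apply,
      Finset.smul_sum]
    refine Finset.sum_congr rfl fun j _ => ?_
    rw [coeff_monomial_mul_extS, LinearMap.smul_apply, Pi.smul_apply, smul_eq_mul, smul_eq_mul,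
      mul_assoc]
    congr 2
    by_cases h : (∀ k, B j k ≤ m.1.1 k) ∧ OKA B ((fun k => m.1.1 k - B j k), m.1.2)
    · refine Eq.trans ?_ (dif_pos ⟨⟨h.1, fun k => Nat.zero_le _⟩, h.2⟩).symm
      show (Option.map c (dite _ _ _)).getD 0 = _
      rw [dif_pos h]
      rfl
    · refine Eq.trans ?_ (dif_neg fun h' => h ⟨h'.1.1, h'.2⟩).symm
      show (Option.map c (dite _ _ _)).getD 0 = _
      rw [dif_neg h]
      rfl
  rw [← hphi]
  rfl

lemma dyF_eq_resS {F : Type} [Field F] {n : ℕ} (π : F) (B : Matrix (Fin n) (Fin n) ℕ)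
    (i : Fin n) (c : RFull F B) :
    dyF F π B i c
      = resS B (diagS (fun m => π⁻¹ * ((lamRow B m.2 i : ℚ) : F)) (extS B c)
        + psiS F B i * extS B c) := by
  funext m
  rw [resS, map_add, coeff_diagS, coeff_extS, dif_pos (show OKA B (ofExp (toExp m.1)) from m.2),
    psiS]
  have hpsi : psidualF F B i c m = coeff (toExp m.1)
      (monomial (toExp (0, fun j => B j i)) 1 * extS B c) := by
    rw [coeff_monomial_mul_extS, one_mul]
    by_cases h : (∀ j, B j i ≤ m.1.2 j) ∧ OKA B (m.1.1, fun j => m.1.2 j - B j i)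
    · refine Eq.trans ?_ (dif_pos ⟨⟨fun k => Nat.zero_le _, h.1⟩, h.2⟩).symm
      show (Option.map c (dite _ _ _)).getD 0 = _
      rw [dif_pos h]
      rfl
    · refine Eq.trans ?_ (dif_neg fun h' => h ⟨h'.1.2, h'.2⟩).symm
      show (Option.map c (dite _ _ _)).getD 0 = _
      rw [dif_neg h]
      rfl
  rw [← hpsi]
  rfl

end SeriesRing

section SeriesFrobenius

open MvPowerSeries

/-- The series `Z_A(x) Z_{Aᵀ}(y)`. -/
noncomputable def ZS (F : Type) [Field F] {n : ℕ} (p : ℕ) (π : F) (A : Matrix (Fin n) (Fin n) ℕ) :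
    MvPowerSeries (Fin n ⊕ Fin n) F :=
  fun a => Zcoef F p π A (ofExp a).1 * Zcoef F p π Aᵀ (ofExp a).2

lemma coeff_ZS {F : Type} [Field F] {n : ℕ} (p : ℕ) (π : F) (A : Matrix (Fin n) (Fin n) ℕ)
    (a : (Fin n ⊕ Fin n) →₀ ℕ) :
    coeff a (ZS F p π A) = Zcoef F p π A (ofExp a).1 * Zcoef F p π Aᵀ (ofExp a).2 := rfl

lemma inCone_ZS {F : Type} [Field F] {n : ℕ} (p : ℕ) (π : F) {A : Matrix (Fin n) (Fin n) ℕ}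
    (hA : (Aq A).det ≠ 0) : InCone A (ZS F p π A) := fun _ ha i =>
  gamRow_nonneg_of_Zcoef_ne_zero (B := Aᵀ) (by rwa [Aq_transpose_det])
    (right_ne_zero_of_mul ha) i

lemma ZmulF_eq_resS {F : Type} [Field F] {n : ℕ} (p : ℕ) (π : F) (A : Matrix (Fin n) (Fin n) ℕ)
    (c : RFull F (p • A)) :
    ZmulF F p π A c = resS A (ZS F p π A * extS (p • A) c) := by
  funext m
  rw [resS, coeff_mul]
  show (∑ δ ∈ _, ∑ ε ∈ _, _) = _
  rw [← Finset.sum_product']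
  symm
  refine Finset.sum_of_injOn (fun q => ofExp q.1) ?_ ?_ ?_ ?_
  · intro q hq q' hq' h
    have h1 : q.1 + q.2 = toExp m.1 := Finset.HasAntidiagonal.mem_antidiagonal.1 hq
    have h2 : q'.1 + q'.2 = toExp m.1 := Finset.HasAntidiagonal.mem_antidiagonal.1 hq'
    have h3 : q.1 = q'.1 := by
      rw [← toExp_ofExp q.1, ← toExp_ofExp q'.1]
      exact congrArg toExp h
    refine Prod.ext h3 ?_
    rw [← h3, ← h1] at h2
    exact (add_left_cancel h2).symm
  · intro q hq
    have h1 : q.1 + q.2 = toExp m.1 := Finset.HasAntidiagonal.mem_antidiagonal.1 hq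
    have h2 : toExp (ofExp q.1) ≤ toExp m.1 := by
      rw [toExp_ofExp, ← h1]
      exact le_self_add
    rw [toExp_le_iff, ofExp_toExp] at h2
    rw [Finset.mem_coe, Finset.mem_product, Fintype.mem_piFinset, Fintype.mem_piFinset]
    refine ⟨fun k => Finset.mem_range_succ_iff.2 ((h2.1 k).trans ?_),
      fun k => Finset.mem_range_succ_iff.2 ((h2.2 k).trans ?_)⟩
    · exact Finset.single_le_sum (f := m.1.1) (fun _ _ => Nat.zero_le _) (Finset.mem_univ k)
    · exact Finset.single_le_sum (f := m.1.2) (fun _ _ => Nat.zero_le _) (Finset.mem_univ k)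
  · intro e _ he
    refine mul_eq_zero_of_right _ (dif_neg fun h => he ?_)
    have hle : toExp e ≤ toExp m.1 := (toExp_le_iff _ _).2 ⟨h.1, h.2.1⟩
    refine ⟨(toExp e, toExp m.1 - toExp e), ?_, ofExp_toExp e⟩
    exact Finset.HasAntidiagonal.mem_antidiagonal.2 (add_tsub_cancel_of_le hle)
  · intro q hq
    have h1 : q.1 + q.2 = toExp m.1 := Finset.HasAntidiagonal.mem_antidiagonal.1 hq
    have h2 : q.1 ≤ toExp m.1 := h1 ▸ le_self_add
    have h3 : ofExp q.2 = ((fun k => m.1.1 k - (ofExp q.1).1 k),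
        fun k => m.1.2 k - (ofExp q.1).2 k) := by
      have : q.2 = toExp m.1 - toExp (ofExp q.1) := by
        rw [toExp_ofExp, ← h1, add_tsub_cancel_left]
      rw [this, ofExp_sub_toExp, ofExp_toExp]
    rw [← toExp_ofExp q.1, toExp_le_iff, ofExp_toExp] at h2
    rw [coeff_ZS, coeff_extS]
    congr 1
    by_cases h : OKA (p • A) (ofExp q.2)
    · rw [dif_pos h]
      refine Eq.trans ?_ (dif_pos ⟨h2.1, h2.2, h3 ▸ h⟩).symm
      congr 1
      exact Subtype.ext h3
    · rw [dif_neg h]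
      symm
      apply dif_neg
      rintro ⟨-, -, h'⟩
      exact h (h3 ▸ h')

lemma coeff_monomial_fst_mul_ZS {F : Type} [Field F] {n : ℕ} (p : ℕ) (π : F)
    (A : Matrix (Fin n) (Fin n) ℕ) (e : Fin n → ℕ) (r : F) (a : (Fin n ⊕ Fin n) →₀ ℕ) :
    coeff a (monomial (toExp (e, 0)) r * ZS F p π A)
      = r * (Zshift F p π A e (ofExp a).1 * Zcoef F p π Aᵀ (ofExp a).2) := by
  rw [coeff_monomial_mul, Zshift]
  by_cases h : ∀ k, e k ≤ (ofExp a).1 k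
  · rw [if_pos ((toExp_le_iff _ _).2 ⟨h, fun k => Nat.zero_le _⟩), if_pos h]
    rfl
  · rw [if_neg fun h' => h ((toExp_le_iff _ _).1 h').1, if_neg h, zero_mul, mul_zero]

lemma coeff_monomial_snd_mul_ZS {F : Type} [Field F] {n : ℕ} (p : ℕ) (π : F)
    (A : Matrix (Fin n) (Fin n) ℕ) (e : Fin n → ℕ) (r : F) (a : (Fin n ⊕ Fin n) →₀ ℕ) :
    coeff a (monomial (toExp (0, e)) r * ZS F p π A)
      = r * (Zcoef F p π A (ofExp a).1 * Zshift F p π Aᵀ e (ofExp a).2) := by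
  rw [coeff_monomial_mul, Zshift]
  by_cases h : ∀ k, e k ≤ (ofExp a).2 k
  · rw [if_pos ((toExp_le_iff _ _).2 ⟨fun k => Nat.zero_le _, h⟩), if_pos h]
    rfl
  · rw [if_neg fun h' => h ((toExp_le_iff _ _).1 h').2, if_neg h, mul_zero, mul_zero]

lemma smul_apply_eq_mul {n p : ℕ} (A : Matrix (Fin n) (Fin n) ℕ) (i j : Fin n) :
    (p • A) i j = p * A i j := rfl

/-- The logarithmic derivative of `Z_A(x)` is `π (W_{pA} - W_A)`. -/
lemma phiS_smul_mul_ZS {F : Type} [Field F] [CharZero F] {n p : ℕ} (hp : 0 < p) (π : F)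
    {A : Matrix (Fin n) (Fin n) ℕ} (hA : (Aq A).det ≠ 0) (i : Fin n) :
    phiS π (p • A) i * ZS F p π A
      = diagS (fun m => (m.1 i : F)) (ZS F p π A) + phiS π A i * ZS F p π A := by
  ext a
  rw [map_add, coeff_diagS, coeff_ZS, phiS, phiS, Finset.sum_mul, Finset.sum_mul, map_sum,
    map_sum, ← mul_assoc, natCast_mul_Zcoef hp π hA, Finset.sum_mul, ← Finset.sum_add_distrib]
  refine Finset.sum_congr rfl fun j _ => ?_
  rw [coeff_monomial_fst_mul_ZS, coeff_monomial_fst_mul_ZS, smul_apply_eq_mul, Nat.cast_mul]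
  change π * ((p : F) * (A j i : F)) * (Zshift F p π A (fun l => p * A j l) _ * _)
    = _ + π * _ * (Zshift F p π A (fun l => A j l) _ * _)
  ring

lemma psiS_smul_mul_ZS {F : Type} [Field F] [CharZero F] {n p : ℕ} (hp : 0 < p) {π : F}
    (hπ : π ≠ 0) {A : Matrix (Fin n) (Fin n) ℕ} (hA : (Aq A).det ≠ 0) (i : Fin n) :
    C (p : F) * (psiS F (p • A) i * ZS F p π A)
      = diagS (fun m => π⁻¹ * ((lamRow A m.2 i : ℚ) : F)) (ZS F p π A)
        + psiS F A i * ZS F p π A := by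
  ext a
  have h := gamRow_mul_Zcoef hp π (B := Aᵀ) (by rwa [Aq_transpose_det]) (ofExp a).2 i
  have h' : ((lamRow A (ofExp a).2 i : ℚ) : F) * Zcoef F p π Aᵀ (ofExp a).2
      = π * (p * Zshift F p π Aᵀ (fun j => (p • A) j i) (ofExp a).2
        - Zshift F p π Aᵀ (fun j => A j i) (ofExp a).2) := h
  have h2 : π⁻¹ * π = 1 := inv_mul_cancel₀ hπ
  rw [map_add, coeff_diagS, coeff_ZS, coeff_C_mul, psiS, psiS, coeff_monomial_snd_mul_ZS,
    coeff_monomial_snd_mul_ZS]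
  generalize Zcoef F p π A (ofExp a).1 = z at *
  linear_combination (-π⁻¹ * z) * h' - z * (p * Zshift F p π Aᵀ (fun j => (p • A) j i) (ofExp a).2
        - Zshift F p π Aᵀ (fun j => A j i) (ofExp a).2) * h2

lemma inCone_phiS {F : Type} [Field F] {n : ℕ} (π : F) (A B : Matrix (Fin n) (Fin n) ℕ)
    (i : Fin n) : InCone A (phiS π B i) := by
  rw [phiS]
  refine InCone.sum _ fun j _ => ?_
  refine InCone.monomial (e := (B j, 0)) (fun k => ?_) _
  exact (lamRow_zero A k).ge

lemma inCone_psiS {F : Type} [Field F] {n : ℕ} {A : Matrix (Fin n) (Fin n) ℕ}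
    (hA : (Aq A).det ≠ 0) (i : Fin n) : InCone A (psiS F A i) := by
  rw [psiS]
  refine InCone.monomial (e := (0, fun j => A j i)) (fun k => ?_) _
  change 0 ≤ lamRow A (fun j => A j i) k
  rw [lamRow_column hA i k]
  split_ifs <;> norm_num

lemma inCone_of_OKA_iff {F : Type} [Field F] {n p : ℕ} (hp : p ≠ 0)
    {A : Matrix (Fin n) (Fin n) ℕ} (hA : (Aq A).det ≠ 0) {f : MvPowerSeries (Fin n ⊕ Fin n) F}
    (hf : InCone (p • A) f) : InCone A f := by
  intro a ha i
  rw [← mul_lamRow_smul hp hA]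
  exact mul_nonneg (Nat.cast_nonneg _) (hf a ha i)

lemma ZmulF_dxF {F : Type} [Field F] [CharZero F] {n p : ℕ} (hp : 0 < p) (π : F)
    {A : Matrix (Fin n) (Fin n) ℕ} (hA : (Aq A).det ≠ 0) (i : Fin n) (c : RFull F (p • A)) :
    ZmulF F p π A (dxF F π (p • A) i c) = dxF F π A i (ZmulF F p π A c) := by
  have hc : InCone A (extS (p • A) c) := InCone.extS (OKA_smul_iff hp.ne' hA) c
  have hZ := inCone_ZS p π hA
  rw [ZmulF_eq_resS, ZmulF_eq_resS, dxF_eq_resS, dxF_eq_resS,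
    resS_mul_extS_resS (OKA_smul_iff hp.ne' hA) hZ
      ((hc.diagS _).add ((inCone_phiS π A (p • A) i).mul hc)),
    resS_add, resS_diagS_extS_resS,
    resS_mul_extS_resS (fun _ => Iff.rfl) (inCone_phiS π A A i) (hZ.mul hc), ← resS_add,
    diagS_mul fun m m' => by simp]
  congr 1
  linear_combination (extS (p • A) c) * phiS_smul_mul_ZS hp π hA i

lemma smul_ZmulF_dyF {F : Type} [Field F] [CharZero F] {n p : ℕ} (hp : 0 < p) {π : F}
    (hπ : π ≠ 0) {A : Matrix (Fin n) (Fin n) ℕ} (hA : (Aq A).det ≠ 0) (i : Fin n)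
    (c : RFull F (p • A)) :
    (p : F) • ZmulF F p π A (dyF F π (p • A) i c) = dyF F π A i (ZmulF F p π A c) := by
  have hc : InCone A (extS (p • A) c) := InCone.extS (OKA_smul_iff hp.ne' hA) c
  have hZ := inCone_ZS p π hA
  have hψ : InCone A (psiS F (p • A) i) :=
    inCone_of_OKA_iff hp.ne' hA (inCone_psiS (Aq_smul_det_ne_zero hp.ne' hA) i)
  have hw : diagS (fun m => π⁻¹ * ((lamRow A m.2 i : ℚ) : F)) (extS (p • A) c)
      = C (p : F) * diagS (fun m => π⁻¹ * ((lamRow (p • A) m.2 i : ℚ) : F)) (extS (p • A) c) := by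
    ext a
    rw [coeff_C_mul, coeff_diagS, coeff_diagS, ← mul_lamRow_smul hp.ne' hA]
    push_cast
    ring
  rw [ZmulF_eq_resS, ZmulF_eq_resS, dyF_eq_resS, dyF_eq_resS,
    resS_mul_extS_resS (OKA_smul_iff hp.ne' hA) hZ ((hc.diagS _).add (hψ.mul hc)),
    resS_add, resS_diagS_extS_resS,
    resS_mul_extS_resS (fun _ => Iff.rfl) (inCone_psiS hA i) (hZ.mul hc), ← resS_add,
    diagS_mul fun m m' => by
      rw [Prod.snd_add, lamRow_add]
      push_cast
      ring, ← resS_C_mul]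
  congr 1
  rw [hw]
  linear_combination (extS (p • A) c) * psiS_smul_mul_ZS hp hπ hA i

end SeriesFrobenius

lemma tmap_id_tmap {F : Type} [Field F] {n : ℕ} {α β γ : Type} (T : (β → F) →ₗ[F] (γ → F))
    (T' : (α → F) →ₗ[F] (β → F)) (L : ExtV F (Fin n) →ₗ[F] ExtV F (Fin n))
    (c : α × Finset (Fin n) → F) :
    tmap T LinearMap.id (tmap T' L c) = tmap (T.comp T') L c := by
  funext ⟨b, S⟩
  rw [tmap_id_apply]
  have h : (fun a => tmap T' L c (a, S))
      = ∑ S' : Finset (Fin n), L (Pi.single S' 1) S • T' (fun m => c (m, S')) := by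
    funext a
    rw [Finset.sum_apply]
    rfl
  rw [h, map_sum, Finset.sum_apply]
  refine Finset.sum_congr rfl fun S' _ => ?_
  rw [_root_.map_smul]
  rfl

lemma tmap_tmap_id {F : Type} [Field F] {n : ℕ} {α β γ : Type} (T : (α → F) →ₗ[F] (β → F))
    (T' : (β → F) →ₗ[F] (γ → F)) (L : ExtV F (Fin n) →ₗ[F] ExtV F (Fin n))
    (c : α × Finset (Fin n) → F) :
    tmap T' L (tmap T LinearMap.id c) = tmap (T'.comp T) L c := by
  funext ⟨b, S⟩
  show ∑ S' : Finset (Fin n), L (Pi.single S' 1) S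
      * T' (fun m => tmap T LinearMap.id c (m, S')) b
    = ∑ S' : Finset (Fin n), L (Pi.single S' 1) S * T' (T fun a => c (a, S')) b
  simp only [tmap_id_apply]

lemma tmap_smul_left {F : Type} [Field F] {n : ℕ} {α β : Type} (r : F)
    (T : (α → F) →ₗ[F] (β → F)) (L : ExtV F (Fin n) →ₗ[F] ExtV F (Fin n)) :
    tmap (r • T) L = r • tmap T L := by
  refine LinearMap.ext fun c => funext fun q => ?_
  show ∑ S : Finset (Fin n), L (Pi.single S 1) q.2 * (r * T (fun m => c (m, S)) q.1)
    = r * ∑ S : Finset (Fin n), L (Pi.single S 1) q.2 * T (fun m => c (m, S)) q.1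
  rw [Finset.mul_sum]
  refine Finset.sum_congr rfl fun S _ => ?_
  rw [mul_left_comm]

lemma tmap_mulE_apply {F : Type} [Field F] {n : ℕ} {α β : Type} (T : (α → F) →ₗ[F] (β → F))
    (i : Fin n) (c : α × Finset (Fin n) → F) (b : β) (S : Finset (Fin n)) :
    tmap T (mulE F i) c (b, S)
      = if i ∈ S then (-1 : F) ^ (S.filter (· < i)).card * T (fun m => c (m, S.erase i)) b
        else 0 := by
  show ∑ S', mulE F i (Pi.single S' 1) S * T (fun m => c (m, S')) b = _
  by_cases hi : i ∈ S
  · rw [if_pos hi, Finset.sum_eq_single (S.erase i)]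
    · show (if i ∈ S then _ else _) * _ = _
      rw [if_pos hi, Pi.single_eq_same, mul_one]
    · intro S' _ hS'
      show (if i ∈ S then _ else _) * _ = _
      rw [if_pos hi, Pi.single_eq_of_ne hS'.symm, mul_zero, zero_mul]
    · exact fun h => absurd (Finset.mem_univ _) h
  · rw [if_neg hi]
    refine Finset.sum_eq_zero fun S' _ => ?_
    show (if i ∈ S then _ else _) * _ = _
    rw [if_neg hi, zero_mul]

lemma tmap_contrE_apply {F : Type} [Field F] {n : ℕ} {α β : Type} (T : (α → F) →ₗ[F] (β → F))
    (i : Fin n) (c : α × Finset (Fin n) → F) (b : β) (S : Finset (Fin n)) :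
    tmap T (contrE F i) c (b, S)
      = if i ∈ S then 0
        else (-1 : F) ^ (S.filter (· < i)).card * T (fun m => c (m, insert i S)) b := by
  show ∑ S', contrE F i (Pi.single S' 1) S * T (fun m => c (m, S')) b = _
  by_cases hi : i ∈ S
  · rw [if_pos hi]
    refine Finset.sum_eq_zero fun S' _ => ?_
    show (if i ∈ S then _ else _) * _ = _
    rw [if_pos hi, zero_mul]
  · rw [if_neg hi, Finset.sum_eq_single (insert i S)]
    · show (if i ∈ S then _ else _) * _ = _
      rw [if_neg hi, Pi.single_eq_same, mul_one]
    · intro S' _ hS'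
      show (if i ∈ S then _ else _) * _ = _
      rw [if_neg hi, Pi.single_eq_of_ne hS'.symm, mul_zero, zero_mul]
    · exact fun h => absurd (Finset.mem_univ _) h

lemma mul_pullOp {F : Type} [Field F] {α β : Type} {σ : β → Option α} {b : β} {r w' : F}
    {w : α → F} (h : ∀ a, σ b = some a → w' = r * w a) (c : α → F) :
    w' * pullOp σ c b = r * pullOp σ (fun a => w a * c a) b := by
  show w' * ((σ b).map c).getD 0 = r * ((σ b).map fun a => w a * c a).getD 0
  cases hσ : σ b with
  | none => simp
  | some a => simp [h a hσ, mul_assoc]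

/-- Commutation of `θ_i + φ_i` with a diagonal operator depending only on `λ`. -/
lemma mul_dxF {F : Type} [Field F] {n : ℕ} {π : F} {B : Matrix (Fin n) (Fin n) ℕ} {i : Fin n}
    {b : AMon B} {r w' : F} {w : AMon B → F}
    (h : b.1.1 i ≠ 0 → ∀ m : AMon B, m.1.2 = b.1.2 → w' = r * w m) (c : RFull F B) :
    w' * dxF F π B i c b = r * dxF F π B i (fun m => w m * c m) b := by
  simp only [dxF, phiF, LinearMap.add_apply, LinearMap.smul_apply, LinearMap.sum_apply,
    Pi.add_apply, Pi.smul_apply, Finset.sum_apply, smul_eq_mul, mul_add]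
  congr 1
  · show w' * ((b.1.1 i : F) * c b) = r * ((b.1.1 i : F) * (w b * c b))
    by_cases hb : b.1.1 i = 0
    · simp [hb]
    · rw [h hb b rfl]
      ring
  · rw [mul_left_comm, mul_left_comm r]
    congr 1
    rw [Finset.mul_sum, Finset.mul_sum]
    refine Finset.sum_congr rfl fun j _ => ?_
    by_cases hB : B j i = 0
    · simp [hB]
    · rw [mul_left_comm, mul_left_comm r]
      congr 1
      refine mul_pullOp (fun a ha => ?_) c
      by_cases hc : (∀ k, B j k ≤ b.1.1 k) ∧ OKA B ((fun k => b.1.1 k - B j k), b.1.2)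
      · rw [dif_pos hc, Option.some.injEq] at ha
        refine h (fun hb => hB (Nat.le_zero.1 (hb ▸ hc.1 i))) a ?_
        rw [← ha]
      · rw [dif_neg hc] at ha
        exact absurd ha (by simp)

/-- Commutation of `T^∨_i + ψ^∨_i` with a diagonal operator that does not involve
`(λ B⁻ᵀ)_i`. -/
lemma mul_dyF {F : Type} [Field F] {n : ℕ} {π : F} {B : Matrix (Fin n) (Fin n) ℕ}
    (hB : (Aq B).det ≠ 0) {i : Fin n} {b : AMon B} {r w' : F} {w : AMon B → F}
    (h : lamRow B b.1.2 i ≠ 0 →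
      ∀ m : AMon B, (∀ k, k ≠ i → lamRow B m.1.2 k = lamRow B b.1.2 k) → w' = r * w m)
    (c : RFull F B) :
    w' * dyF F π B i c b = r * dyF F π B i (fun m => w m * c m) b := by
  simp only [dyF, psidualF, LinearMap.add_apply, Pi.add_apply, mul_add]
  congr 1
  · show w' * (π⁻¹ * ((lamRow B b.1.2 i : ℚ) : F) * c b)
      = r * (π⁻¹ * ((lamRow B b.1.2 i : ℚ) : F) * (w b * c b))
    by_cases hb : lamRow B b.1.2 i = 0
    · simp [hb]
    · rw [h hb b fun _ _ => rfl]
      ring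
  · refine mul_pullOp (fun a ha => ?_) c
    by_cases hc : (∀ j, B j i ≤ b.1.2 j) ∧ OKA B (b.1.1, fun j => b.1.2 j - B j i)
    · rw [dif_pos hc, Option.some.injEq] at ha
      have hb : b.1.2 = a.1.2 + fun j => B j i := by
        rw [← ha]
        exact funext fun j => (Nat.sub_add_cancel (hc.1 j)).symm
      have hk (k : Fin n) : lamRow B b.1.2 k = lamRow B a.1.2 k + if k = i then 1 else 0 := by
        rw [hb, lamRow_add, lamRow_column hB]
      refine h ?_ a fun k hki => by rw [hk, if_neg hki, add_zero]
      have ha0 := a.2.1 i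
      rw [hk, if_pos rfl]
      positivity
    · rw [dif_neg hc] at ha
      exact absurd ha (by simp)

lemma pQdualdiag_tmap_dxF {F : Type} [Field F] {n : ℕ} (p : ℕ) (π : F)
    (B : Matrix (Fin n) (Fin n) ℕ) (i : Fin n) (c : BFull F B) :
    pQdualdiag F p B (tmap (dxF F π B i) (mulE F i) c)
      = tmap (dxF F π B i) (mulE F i) (pQdualdiag F p B c) := by
  funext ⟨b, S⟩
  show (p : F) ^ qexpDual B (b, S) * tmap (dxF F π B i) (mulE F i) c (b, S) = _
  rw [tmap_mulE_apply, tmap_mulE_apply]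
  by_cases hi : i ∈ S
  · rw [if_pos hi, if_pos hi, mul_left_comm]
    congr 1
    have key := mul_dxF (π := π) (B := B) (i := i) (b := b) (r := 1)
      (w' := (p : F) ^ qexpDual B (b, S))
      (w := fun m => (p : F) ^ qexpDual B (m, S.erase i)) ?_ fun m => c (m, S.erase i)
    · rw [key, one_mul]
      rfl
    · intro hb m hm
      rw [one_mul]
      have hl : lamRow B b.1.2 i = 0 := (((OKA_iff B b.1).1 b.2).2 i).resolve_left hb
      rw [qexpDual, qexpDual]
      congr 2
      ext k
      rw [Finset.mem_filter, Finset.mem_filter, hm, Finset.mem_erase]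
      by_cases hk : k = i
      · subst hk
        simp [hl]
      · simp [hk]
  · rw [if_neg hi, if_neg hi, mul_zero]

lemma pQdualdiag_tmap_dyF {F : Type} [Field F] {n : ℕ} (p : ℕ) (π : F)
    {B : Matrix (Fin n) (Fin n) ℕ} (hB : (Aq B).det ≠ 0) (i : Fin n) (c : BFull F B) :
    pQdualdiag F p B (tmap (dyF F π B i) (contrE F i) c)
      = (p : F) • tmap (dyF F π B i) (contrE F i) (pQdualdiag F p B c) := by
  funext ⟨b, S⟩
  show (p : F) ^ qexpDual B (b, S) * tmap (dyF F π B i) (contrE F i) c (b, S)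
    = (p : F) * tmap (dyF F π B i) (contrE F i) (pQdualdiag F p B c) (b, S)
  rw [tmap_contrE_apply, tmap_contrE_apply]
  by_cases hi : i ∈ S
  · rw [if_pos hi, if_pos hi, mul_zero, mul_zero]
  · rw [if_neg hi, if_neg hi, mul_left_comm, mul_left_comm (p : F)]
    congr 1
    refine mul_dyF (w := fun m => (p : F) ^ qexpDual B (m, insert i S)) hB ?_ _
    intro hb m hm
    rw [← pow_succ']
    congr 1
    have hnot : i ∉ Finset.univ.filter fun k => k ∉ insert i S ∧ lamRow B m.1.2 k ≠ 0 := by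
      simp
    rw [qexpDual, qexpDual, ← Finset.card_insert_of_notMem hnot]
    congr 1
    ext k
    by_cases hk : k = i
    · subst hk
      simp [hi, hb]
    · simp [hk, hm k hk]

lemma FrDoublePrime_comp_dFull {F : Type} [Field F] [CharZero F] {n p : ℕ} (hp : 0 < p) {π : F}
    (hπ : π ≠ 0) {A : Matrix (Fin n) (Fin n) ℕ} (hA : (Aq A).det ≠ 0) :
    (FrDoublePrime F p π A).comp (dFull F π (p • A))
      = (dFull F π A).comp (FrDoublePrime F p π A) := by
  have hdx (i : Fin n) : (ZmulF F p π A).comp (dxF F π (p • A) i)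
      = (dxF F π A i).comp (ZmulF F p π A) := LinearMap.ext fun c => ZmulF_dxF hp π hA i c
  have hdy (i : Fin n) : (p : F) • (ZmulF F p π A).comp (dyF F π (p • A) i)
      = (dyF F π A i).comp (ZmulF F p π A) := LinearMap.ext fun c => smul_ZmulF_dyF hp hπ hA i c
  refine LinearMap.ext fun c => ?_
  simp only [FrDoublePrime, dFull, LinearMap.comp_apply, LinearMap.add_apply,
    LinearMap.sum_apply, map_add, map_sum]
  congr 1
  · refine Finset.sum_congr rfl fun i _ => ?_
    rw [pQdualdiag_tmap_dxF, tmap_id_tmap, tmap_tmap_id, hdx]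
  · refine Finset.sum_congr rfl fun i _ => ?_
    rw [pQdualdiag_tmap_dyF p π (Aq_smul_det_ne_zero hp.ne' hA), _root_.map_smul, tmap_id_tmap,
      tmap_tmap_id, ← hdy, tmap_smul_left, LinearMap.smul_apply]

/-- Lemma 9.2: over a `ℂ_p`-like field, the series `Z_A(x) = exp(π(W_{pA} − W_A))` is
overconvergent, multiplication by `Z_A(x)Z_{Aᵀ}(y)` is a well-defined map
`R^†_{pA}(K) → R^†_A(K)`, and `Fr''_A = (Θ''_A ⊗ Id) ∘ p^{Q^∨_{pA}}` is a chain map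
`B^†_{pA}(K) → B^†_A(K)`: `Fr''_A ∘ (d_{pA} + d^∨_{pA}) = (d_A + d^∨_A) ∘ Fr''_A`. -/
theorem FrDoublePrime_chain_map
    (p : ℕ) [hp : Fact p.Prime] (K : Type) [NontriviallyNormedField K] [CompleteSpace K]
    [CharZero K] (halg : IsAlgClosed K)
    (hna : ∀ a b : K, ‖a + b‖ ≤ max ‖a‖ ‖b‖) (hpnorm : ‖(p : K)‖ = (p : ℝ)⁻¹)
    (π : K) (hπ : π ^ (p - 1) = -(p : K))
    (n : ℕ) (A : Matrix (Fin n) (Fin n) ℕ)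
    (hdet : 0 < (A.map ((↑) : ℕ → ℤ)).det ∧ (A.map ((↑) : ℕ → ℤ)).det < (p : ℤ))
    (hABH : IsBH (AlgebraicClosure (ZMod p)) A) :
    (∃ M : ℝ, 0 < M ∧
      {δ : Fin n → ℕ |
        ¬ ‖Zcoef K p π A δ‖ ≤ (p : ℝ) ^ (-(M * ((∑ i, δ i : ℕ) : ℝ)))}.Finite) ∧
    (∀ c : RFull K (p • A), OvercR p c → OvercR p (ZmulF K p π A c)) ∧
    (∀ c : BFull K (p • A), OvercB p c → OvercB p (FrDoublePrime K p π A c)) ∧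
    (FrDoublePrime K p π A).comp (dFull K π (p • A))
      = (dFull K π A).comp (FrDoublePrime K p π A) := by
  have : IsUltrametricDist K :=
    IsUltrametricDist.isUltrametricDist_of_forall_norm_add_le_max_norm hna
  have hA : (Aq A).det ≠ 0 := hABH.1
  have hp0 : 0 < p := hp.out.pos
  have hπ0 : π ≠ 0 := by
    rintro rfl
    have h0 : (p : K) ≠ 0 := Nat.cast_ne_zero.2 hp0.ne'
    rw [zero_pow (by have := hp.out.two_le; omega), eq_comm, neg_eq_zero] at hπ
    exact h0 hπ
  obtain ⟨r, hr0, hr1, hr⟩ := exists_norm_Zcoef_le_pow hpnorm hπ hA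
  obtain ⟨s, hs0, hs1, hs⟩ := exists_norm_Zcoef_le_pow hpnorm hπ (B := Aᵀ)
    (by rwa [Aq_transpose_det])
  have ht0 : 0 < max r s := lt_max_of_lt_left hr0
  have ht1 : max r s < 1 := max_lt hr1 hs1
  have hA' (δ : Fin n → ℕ) : ‖Zcoef K p π A δ‖ ≤ max r s ^ (∑ i, δ i) :=
    (hr δ).trans (pow_le_pow_left₀ hr0.le (le_max_left r s) _)
  have hAT' (δ : Fin n → ℕ) : ‖Zcoef K p π Aᵀ δ‖ ≤ max r s ^ (∑ i, δ i) :=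
    (hs δ).trans (pow_le_pow_left₀ hs0.le (le_max_right r s) _)
  refine ⟨?_, fun c hc => overcR_ZmulF ht0 ht1 hA' hAT' hc,
    fun c hc => overcB_FrDoublePrime ht0 ht1 hA' hAT' hc, FrDoublePrime_comp_dFull hp0 hπ0 hA⟩
  refine overconvergent_of_geometric_bound (d := fun δ : Fin n → ℕ => ∑ i, δ i)
    (f := Zcoef K p π A) (C := 1) (t := r) ?_ hr0 hr1 fun δ => by rw [one_mul]; exact hr δ
  intro N
  refine (Set.finite_Icc (0 : Fin n → ℕ) fun _ => N).subset fun δ hδ => ?_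
  refine ⟨fun i => Nat.zero_le _, fun i => le_trans ?_ hδ⟩
  exact Finset.single_le_sum (f := δ) (fun _ _ => Nat.zero_le _) (Finset.mem_univ i)
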